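/- Let u : ℝⁿ × (0,∞) → ℝ be a classical solution (C² in the space variable and C¹ in the time variable on ℝⁿ × (0,∞), continuous up to t = 0) of the equation u_t = Δu + |u|^p V on ℝⁿ × (0,∞), where Δ is the Laplacian in the space variables. Assume u is bounded from below, u(·,0) = u₀ ≥ 0, V : ℝⁿ × (0,∞) → ℝ is continuous and positive, V satisfies the conditions (VOL) with exponent α > 0, and 1 < p ≤ 1 + 2/α. Then u ≡ 0 on ℝⁿ × [0,∞). -/

import Mathlib

open MeasureTheory Real Set

/-- The Laplacian in the space variables on Euclidean space: the sum of the pure second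
directional derivatives along the standard coordinate directions. -/
noncomputable def laplacian {n : ℕ} (f : EuclideanSpace ℝ (Fin n) → ℝ)
    (x : EuclideanSpace ℝ (Fin n)) : ℝ :=
  ∑ i, fderiv ℝ (fun y => fderiv ℝ f y (EuclideanSpace.single i 1)) x (EuclideanSpace.single i 1)


open Filter Topology

/-- Discrete heat operator. -/
noncomputable def Dh {n : ℕ} (w : EuclideanSpace ℝ (Fin n) × ℝ → ℝ) (s : ℝ)
    (q : EuclideanSpace ℝ (Fin n) × ℝ) : ℝ :=
  (w q - w (q.1, q.2 - s ^ 2)) / s ^ 2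
    - ∑ i, (w (q.1 + s • EuclideanSpace.single i 1, q.2)
        + w (q.1 - s • EuclideanSpace.single i 1, q.2) - 2 * w q) / s ^ 2

lemma Dh_add {n : ℕ} (w v : EuclideanSpace ℝ (Fin n) × ℝ → ℝ) (s : ℝ)
    (q : EuclideanSpace ℝ (Fin n) × ℝ) :
    Dh (fun z => w z + v z) s q = Dh w s q + Dh v s q := by
  unfold Dh
  rw [sub_add_sub_comm, ← Finset.sum_add_distrib]
  congr 1
  · ring
  · apply Finset.sum_congr rfl; intros; ring

lemma Dh_smul {n : ℕ} (c : ℝ) (w : EuclideanSpace ℝ (Fin n) × ℝ → ℝ) (s : ℝ)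
    (q : EuclideanSpace ℝ (Fin n) × ℝ) :
    Dh (fun z => c * w z) s q = c * Dh w s q := by
  unfold Dh
  rw [mul_sub, Finset.mul_sum]
  congr 1
  · ring
  · apply Finset.sum_congr rfl; intros; ring

lemma Dh_quad {n : ℕ} (a b c : ℝ) (s : ℝ) (hs : s ≠ 0)
    (q : EuclideanSpace ℝ (Fin n) × ℝ) :
    Dh (fun z : EuclideanSpace ℝ (Fin n) × ℝ => a * ‖z.1‖ ^ 2 + b * z.2 ^ 2 + c * z.2) s q
      = b * (2 * q.2 - s ^ 2) + c - 2 * n * a := by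
  unfold Dh
  have h1 : ∀ i : Fin n, ‖q.1 + s • EuclideanSpace.single i (1:ℝ)‖ ^ 2
      + ‖q.1 - s • EuclideanSpace.single i (1:ℝ)‖ ^ 2 = 2 * ‖q.1‖ ^ 2 + 2 * s ^ 2 := by
    intro i
    have := parallelogram_law_with_norm ℝ q.1 (s • EuclideanSpace.single i (1:ℝ))
    have h2 : ‖s • EuclideanSpace.single i (1:ℝ)‖ = |s| := by simp [norm_smul]
    rw [h2] at this
    have h3 := sq_abs s
    nlinarith
  have h4 : ∀ i : Fin n, ((a * ‖q.1 + s • EuclideanSpace.single i (1:ℝ)‖ ^ 2 + b * q.2 ^ 2 + c * q.2)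
      + (a * ‖q.1 - s • EuclideanSpace.single i (1:ℝ)‖ ^ 2 + b * q.2 ^ 2 + c * q.2)
      - 2 * (a * ‖q.1‖ ^ 2 + b * q.2 ^ 2 + c * q.2)) / s ^ 2 = 2 * a := by
    intro i
    rw [div_eq_iff (by positivity)]
    linear_combination a * h1 i
  simp only [h4]
  simp only [Finset.sum_const, Finset.card_univ, Fintype.card_fin, nsmul_eq_mul]
  field_simp
  ring

/-- at a minimum the discrete operator is nonpositive -/
lemma Dh_nonpos_of_min {n : ℕ} (w : EuclideanSpace ℝ (Fin n) × ℝ → ℝ) (s : ℝ)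
    (q : EuclideanSpace ℝ (Fin n) × ℝ)
    (h1 : w q ≤ w (q.1, q.2 - s ^ 2))
    (h2 : ∀ i, w q ≤ w (q.1 + s • EuclideanSpace.single i 1, q.2))
    (h3 : ∀ i, w q ≤ w (q.1 - s • EuclideanSpace.single i 1, q.2)) : Dh w s q ≤ 0 := by
  unfold Dh
  have a1 : (w q - w (q.1, q.2 - s ^ 2)) / s ^ 2 ≤ 0 :=
    div_nonpos_of_nonpos_of_nonneg (by linarith) (by positivity)
  have a2 : 0 ≤ ∑ i, (w (q.1 + s • EuclideanSpace.single i 1, q.2)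
        + w (q.1 - s • EuclideanSpace.single i 1, q.2) - 2 * w q) / s ^ 2 := by
    apply Finset.sum_nonneg
    intro i _
    apply div_nonneg _ (by positivity)
    linarith [h2 i, h3 i]
  linarith

lemma second_diff (f f' : ℝ → ℝ) (b : ℝ) (hf : ∀ s, HasDerivAt f (f' s) s)
    (hb : HasDerivAt f' b 0) :
    Tendsto (fun s => (f s + f (-s) - 2 * f 0) / s ^ 2) (𝓝[>] 0) (𝓝 b) := by
  have hfc : Continuous f := continuous_iff_continuousAt.2 fun s => (hf s).continuousAt
  refine HasDerivAt.lhopital_zero_nhdsGT (f' := fun s => f' s - f' (-s)) (g' := fun s => 2 * s)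
    ?_ ?_ ?_ ?_ ?_ ?_
  · filter_upwards with s
    have h1 := (hf s)
    have h2 : HasDerivAt (fun s => f (-s)) (f' (-s) * (-1)) s :=
      HasDerivAt.comp s (hf (-s)) (hasDerivAt_neg s)
    exact ((h1.add h2).sub_const (2 * f 0)).congr_deriv (by ring)
  · filter_upwards with s
    simpa using hasDerivAt_pow 2 s
  · filter_upwards [self_mem_nhdsWithin] with s hs
    have : (0:ℝ) < s := hs
    positivity
  · have : Continuous (fun s => f s + f (-s) - 2 * f 0) := by fun_prop
    have h := this.tendsto 0
    simp only [neg_zero] at h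
    have e : f 0 + f 0 - 2 * f 0 = 0 := by ring
    rw [e] at h
    exact h.mono_left nhdsWithin_le_nhds
  · have : Continuous (fun s : ℝ => s ^ 2) := by fun_prop
    have h := this.tendsto 0
    simp only [ne_eq, OfNat.ofNat_ne_zero, not_false_eq_true, zero_pow] at h
    exact h.mono_left nhdsWithin_le_nhds
  · have h2 : HasDerivAt (fun s => f' (-s)) (b * (-1)) 0 := by
      apply HasDerivAt.comp (0:ℝ) (h₂ := f') _ (hasDerivAt_neg 0)
      simpa using hb
    have h3 := (hb.sub h2).tendsto_slope_zero_right
    have h4 := h3.const_mul (1/2 : ℝ)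
    have e : (1/2 : ℝ) * (b - b * -1) = b := by ring
    rw [e] at h4
    refine h4.congr' ?_
    filter_upwards [self_mem_nhdsWithin] with s hs
    have : (0:ℝ) < s := hs
    simp
    field_simp

lemma time_diff (f : ℝ → ℝ) (t b : ℝ) (hf : HasDerivAt f b t) :
    Tendsto (fun s => (f t - f (t - s ^ 2)) / s ^ 2) (𝓝[>] 0) (𝓝 b) := by
  have h1 := hf.tendsto_slope_zero_left
  have h2 : Tendsto (fun s : ℝ => - s ^ 2) (𝓝[>] 0) (𝓝[<] 0) := by
    apply tendsto_nhdsWithin_of_tendsto_nhds_of_eventually_within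
    · have : Continuous (fun s : ℝ => - s ^ 2) := by fun_prop
      have h := this.tendsto 0
      simp only [ne_eq, OfNat.ofNat_ne_zero, not_false_eq_true, zero_pow, neg_zero] at h
      exact h.mono_left nhdsWithin_le_nhds
    · filter_upwards [self_mem_nhdsWithin] with s hs
      have : (0:ℝ) < s := hs
      simp only [mem_Iio, Left.neg_neg_iff]
      positivity
  refine (h1.comp h2).congr' ?_
  filter_upwards [self_mem_nhdsWithin] with s hs
  have : (0:ℝ) < s := hs
  simp only [Function.comp, smul_eq_mul]
  rw [← sub_eq_add_neg]
  field_simp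
  ring

lemma Dh_tendsto {n : ℕ} (w : EuclideanSpace ℝ (Fin n) × ℝ → ℝ)
    (q : EuclideanSpace ℝ (Fin n) × ℝ) (a : ℝ) (b : Fin n → ℝ)
    (ha : HasDerivAt (fun t => w (q.1, t)) a q.2)
    (hb : ∀ i, ∃ d : ℝ → ℝ, (∀ s, HasDerivAt
      (fun s : ℝ => w (q.1 + s • EuclideanSpace.single i 1, q.2)) (d s) s) ∧
        HasDerivAt d (b i) 0) :
    Tendsto (fun s => Dh w s q) (𝓝[>] 0) (𝓝 (a - ∑ i, b i)) := by
  unfold Dh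
  apply Tendsto.sub
  · exact time_diff (fun t => w (q.1, t)) q.2 a ha
  · apply tendsto_finsetSum
    intro i _
    obtain ⟨d, h1, h2⟩ := hb i
    have := second_diff _ d (b i) h1 h2
    simpa [sub_eq_add_neg] using this

lemma min_principle {n : ℕ} (u : EuclideanSpace ℝ (Fin n) × ℝ → ℝ)
    (hc : ContinuousOn u {q | 0 ≤ q.2}) (A : ℝ) (hA : ∀ q, 0 ≤ q.2 → A ≤ u q)
    (h0 : ∀ q, q.2 = 0 → 0 ≤ u q)
    (hD : ∀ q, 0 < q.2 → ∀ ε > 0, ∀ᶠ s in 𝓝[>] (0:ℝ), -ε ≤ Dh u s q) :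
    ∀ q, 0 ≤ q.2 → 0 ≤ u q := by
  -- for every ε
  have key : ∀ ε > 0, ∀ q : EuclideanSpace ℝ (Fin n) × ℝ, 0 ≤ q.2 →
      0 ≤ u q + (ε * ‖q.1‖ ^ 2 + 0 * q.2 ^ 2 + ε * (2 * n + 1) * q.2) := by
    intro ε hε q₀ hq₀
    by_contra hneg
    push Not at hneg
    set Q : EuclideanSpace ℝ (Fin n) × ℝ → ℝ :=
      fun q => ε * ‖q.1‖ ^ 2 + 0 * q.2 ^ 2 + ε * (2 * n + 1) * q.2 with hQ
    set w : EuclideanSpace ℝ (Fin n) × ℝ → ℝ := fun q => u q + Q q with hw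
    obtain ⟨R, hR1, hR2⟩ : ∃ R : ℝ, ‖q₀.1‖ ≤ R ∧ 0 < A + ε * R ^ 2 := by
      have : Tendsto (fun R : ℝ => A + ε * R ^ 2) atTop atTop :=
        tendsto_atTop_add_const_left _ _ ((tendsto_pow_atTop two_ne_zero).const_mul_atTop hε)
      obtain ⟨R, h1, h2⟩ := ((this.eventually_gt_atTop 0).and (eventually_ge_atTop ‖q₀.1‖)).exists
      exact ⟨R, h2, h1⟩
    set K : Set (EuclideanSpace ℝ (Fin n) × ℝ) := Metric.closedBall 0 R ×ˢ Icc 0 q₀.2 with hK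
    have hKc : IsCompact K := (isCompact_closedBall _ _).prod isCompact_Icc
    have hq₀K : q₀ ∈ K := by
      refine ⟨by simpa using hR1, hq₀, le_rfl⟩
    have hQc : Continuous Q := by rw [hQ]; fun_prop
    have hwc : ContinuousOn w K :=
      (hc.mono (fun q hq => hq.2.1)).add hQc.continuousOn
    obtain ⟨q, hqK, hqm⟩ := hKc.exists_isMinOn ⟨q₀, hq₀K⟩ hwc
    have hwq : w q < 0 := lt_of_le_of_lt (hqm hq₀K) hneg
    have hqt : 0 ≤ q.2 := hqK.2.1
    have hqt' : 0 < q.2 := by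
      rcases hqt.lt_or_eq with h | h
      · exact h
      · exfalso
        have h1 := h0 q h.symm
        have h2 : 0 ≤ Q q := by simp only [hQ]; positivity
        simp only [hw] at hwq
        linarith
    have hqx : ‖q.1‖ < R := by
      have h1 : ‖q.1‖ ≤ R := by simpa using hqK.1
      rcases h1.lt_or_eq with h | h
      · exact h
      · exfalso
        have h1 := hA q hqt
        have h2 : ε * R ^ 2 ≤ Q q := by
          simp only [hQ, h]
          have : 0 ≤ ε * (2 * n + 1) * q.2 := by positivity
          linarith
        simp only [hw] at hwq
        linarith
    have e1 : ∀ᶠ s in 𝓝[>] (0:ℝ), s ^ 2 < q.2 := by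
      have : Continuous (fun s : ℝ => s ^ 2) := by fun_prop
      have h := this.tendsto 0
      simp only [ne_eq, OfNat.ofNat_ne_zero, not_false_eq_true, zero_pow] at h
      exact (h.mono_left nhdsWithin_le_nhds).eventually (gt_mem_nhds hqt')
    have e2 : ∀ᶠ s in 𝓝[>] (0:ℝ), s < R - ‖q.1‖ :=
      nhdsWithin_le_nhds (gt_mem_nhds (by linarith))
    obtain ⟨s, ⟨⟨hs1, hs2⟩, hs3⟩, hs4⟩ :=
      (((e1.and e2).and self_mem_nhdsWithin).and (hD q hqt' (ε / 2) (by positivity))).exists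
    have hs : 0 < s := hs3
    have hn : ∀ i : Fin n, ‖s • EuclideanSpace.single i (1:ℝ)‖ = s := by
      intro i; simp [norm_smul, abs_of_pos hs]
    have hle : Dh w s q ≤ 0 := by
      apply Dh_nonpos_of_min
      · apply hqm
        exact ⟨hqK.1, by simp only [mem_Icc]; constructor <;> nlinarith [hqK.2.2]⟩
      · intro i
        apply hqm
        refine ⟨?_, hqK.2⟩
        simp only [Metric.mem_closedBall, dist_zero_right]
        linarith [norm_add_le q.1 (s • EuclideanSpace.single i (1:ℝ)), hn i]
      · intro i
        apply hqm
        refine ⟨?_, hqK.2⟩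
        simp only [Metric.mem_closedBall, dist_zero_right]
        linarith [norm_sub_le q.1 (s • EuclideanSpace.single i (1:ℝ)), hn i]
    rw [hw, Dh_add, hQ, Dh_quad _ _ _ _ hs.ne'] at hle
    nlinarith
  intro q hq
  by_contra hneg
  push Not at hneg
  set B := ‖q.1‖ ^ 2 + (2 * n + 1) * q.2 with hB
  have hB0 : 0 ≤ B := by positivity
  have := key (-u q / (2 * (B + 1))) (div_pos (by linarith) (by positivity)) q hq
  have h2 : -u q / (2 * (B + 1)) * ‖q.1‖ ^ 2 + 0 * q.2 ^ 2
      + -u q / (2 * (B + 1)) * (2 * n + 1) * q.2 = -u q / (2 * (B + 1)) * B := by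
    rw [hB]; ring
  rw [h2] at this
  have h3 : -u q / (2 * (B + 1)) * B ≤ -u q / 2 := by
    rw [div_mul_eq_mul_div, div_le_div_iff₀ (by positivity) (by norm_num)]
    nlinarith
  linarith

/-- stability under uniform limits -/
lemma stability {n : ℕ} (r : ℝ) (hr : 0 < r) (U ℓ G : EuclideanSpace ℝ (Fin n) × ℝ → ℝ)
    (hU : Continuous U) (hℓ : ContinuousAt ℓ 0) (hG : ContinuousAt G 0)
    (hUD : ∀ q, Tendsto (fun s => Dh U s q) (𝓝[>] 0) (𝓝 (ℓ q)))
    (happ : ∀ η > 0, ∃ w h : EuclideanSpace ℝ (Fin n) × ℝ → ℝ,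
      ContinuousOn w (Metric.closedBall 0 r) ∧
      (∀ q ∈ Metric.closedBall 0 r, |w q - U q| ≤ η) ∧
      (∀ q ∈ Metric.closedBall 0 r, |h q - G q| ≤ η) ∧
      (∀ q ∈ Metric.ball 0 r, ∀ ε > 0, ∀ᶠ s in 𝓝[>] (0:ℝ), h q - ε ≤ Dh w s q)) :
    G 0 ≤ ℓ 0 := by
  by_contra hlt
  push Not at hlt
  set δ := (G 0 - ℓ 0) / 10 with hδ
  have hδ0 : 0 < δ := by rw [hδ]; linarith
  obtain ⟨ρ, hρ0, hρr, hρ⟩ : ∃ ρ > 0, ρ < r ∧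
      ∀ q ∈ Metric.closedBall (0 : EuclideanSpace ℝ (Fin n) × ℝ) ρ,
        ℓ q < ℓ 0 + δ ∧ G 0 - δ < G q := by
    have e1 : ∀ᶠ q in 𝓝 (0 : EuclideanSpace ℝ (Fin n) × ℝ), ℓ q < ℓ 0 + δ :=
      hℓ.eventually (gt_mem_nhds (by linarith))
    have e2 : ∀ᶠ q in 𝓝 (0 : EuclideanSpace ℝ (Fin n) × ℝ), G 0 - δ < G q :=
      hG.eventually (lt_mem_nhds (by linarith))
    obtain ⟨ρ, h1, h2⟩ := Metric.nhds_basis_closedBall.mem_iff.1 (e1.and e2)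
    refine ⟨min ρ (r / 2), by positivity, by
      have := min_le_right ρ (r/2); linarith, fun q hq => h2 ?_⟩
    exact Metric.closedBall_subset_closedBall (min_le_left _ _) hq
  set ε := δ / (2 * ρ + 1 + 2 * n) with hε
  have hε0 : 0 < ε := by positivity
  have hεm : ε * (2 * ρ + 1 + 2 * n) = δ := by rw [hε]; field_simp
  set η := min δ (ε * ρ ^ 2 / 3) with hη
  have hη0 : 0 < η := by positivity
  obtain ⟨w, h, hwc, hw, hh, hD⟩ := happ η hη0
  set Q : EuclideanSpace ℝ (Fin n) × ℝ → ℝ :=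
      fun q => ε * ‖q.1‖ ^ 2 + ε * q.2 ^ 2 + 0 * q.2 with hQ
  have hQc : Continuous Q := by rw [hQ]; fun_prop
  set F : EuclideanSpace ℝ (Fin n) × ℝ → ℝ := fun q => w q + (-1 * U q + Q q) with hF
  have hsub : Metric.closedBall (0 : EuclideanSpace ℝ (Fin n) × ℝ) ρ ⊆ Metric.closedBall 0 r :=
    Metric.closedBall_subset_closedBall hρr.le
  have hFc : ContinuousOn F (Metric.closedBall 0 ρ) :=
    (hwc.mono hsub).add ((hU.const_mul _).add hQc).continuousOn
  have h0m : (0 : EuclideanSpace ℝ (Fin n) × ℝ) ∈ Metric.closedBall 0 ρ := by simp [hρ0.le]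
  obtain ⟨q, hqK, hqm⟩ := (isCompact_closedBall (0 : EuclideanSpace ℝ (Fin n) × ℝ)
    ρ).exists_isMinOn ⟨0, h0m⟩ hFc
  have hF0 : F 0 ≤ η := by
    have := (abs_le.1 (hw 0 (hsub h0m))).2
    simp only [hF, hQ]
    simp
    linarith
  have hqn : ‖q‖ < ρ := by
    have h1 : ‖q‖ ≤ ρ := by simpa using hqK
    rcases h1.lt_or_eq with h | h
    · exact h
    · exfalso
      have h2 := (abs_le.1 (hw q (hsub hqK))).1
      have h3 : F q ≤ F 0 := hqm h0m
      have h4 : ε * ρ ^ 2 ≤ Q q := by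
        have : ρ ^ 2 ≤ ‖q.1‖ ^ 2 + q.2 ^ 2 := by
          rw [← h, Prod.norm_def]
          rcases max_choice ‖q.1‖ ‖q.2‖ with h5 | h5
          · rw [h5]; nlinarith [sq_nonneg q.2]
          · rw [h5]; rw [Real.norm_eq_abs, sq_abs]; nlinarith [sq_nonneg ‖q.1‖]
        simp only [hQ]
        nlinarith
      have h5 : η ≤ ε * ρ ^ 2 / 3 := min_le_right _ _
      have h6 : 0 < ε * ρ ^ 2 := by positivity
      have h7 : F q = w q + (-1 * U q + Q q) := rfl
      linarith
  have e1 : ∀ᶠ s in 𝓝[>] (0:ℝ), s ^ 2 < min 1 (ρ - ‖q‖) := by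
    have : Continuous (fun s : ℝ => s ^ 2) := by fun_prop
    have h := this.tendsto 0
    simp only [ne_eq, OfNat.ofNat_ne_zero, not_false_eq_true, zero_pow] at h
    exact (h.mono_left nhdsWithin_le_nhds).eventually (gt_mem_nhds (by
      apply lt_min one_pos; linarith))
  have e2 : ∀ᶠ s in 𝓝[>] (0:ℝ), s < ρ - ‖q‖ :=
    nhdsWithin_le_nhds (gt_mem_nhds (by linarith))
  have e3 := hD q (by simp; linarith) δ hδ0
  have e4 := (hUD q).eventually (gt_mem_nhds (show ℓ q < ℓ q + δ by linarith))
  obtain ⟨s, ⟨⟨⟨hs1, hs2⟩, hs3⟩, hs4⟩, hs5⟩ :=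
      ((((e1.and e2).and self_mem_nhdsWithin).and e3).and e4).exists
  have hs : 0 < s := hs3
  have hs1a : s ^ 2 < 1 := lt_of_lt_of_le hs1 (min_le_left _ _)
  have hs1b : s ^ 2 < ρ - ‖q‖ := lt_of_lt_of_le hs1 (min_le_right _ _)
  have hn : ∀ i : Fin n, ‖s • EuclideanSpace.single i (1:ℝ)‖ = s := by
    intro i; simp [norm_smul, abs_of_pos hs]
  have hq1 : ‖q.1‖ ≤ ‖q‖ := norm_fst_le q
  have hq2 : ‖q.2‖ ≤ ‖q‖ := norm_snd_le q
  have hq2' := abs_le.1 (show |q.2| ≤ ‖q‖ from hq2)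
  have hle : Dh F s q ≤ 0 := by
    apply Dh_nonpos_of_min
    · apply hqm
      simp only [Metric.mem_closedBall, dist_zero_right, Prod.norm_def, sup_le_iff]
      refine ⟨by linarith, ?_⟩
      rw [Real.norm_eq_abs, abs_le]
      constructor <;> nlinarith
    · intro i
      apply hqm
      simp only [Metric.mem_closedBall, dist_zero_right, Prod.norm_def, sup_le_iff]
      refine ⟨?_, by linarith⟩
      linarith [norm_add_le q.1 (s • EuclideanSpace.single i (1:ℝ)), hn i]
    · intro i
      apply hqm
      simp only [Metric.mem_closedBall, dist_zero_right, Prod.norm_def, sup_le_iff]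
      refine ⟨?_, by linarith⟩
      linarith [norm_sub_le q.1 (s • EuclideanSpace.single i (1:ℝ)), hn i]
  rw [hF, Dh_add, Dh_add, Dh_smul, hQ, Dh_quad _ _ _ _ hs.ne'] at hle
  have h1 := (abs_le.1 (hh q (hsub hqK))).1
  have h2 : η ≤ δ := min_le_left _ _
  obtain ⟨h3, h4⟩ := hρ q hqK
  have h5 : -δ ≤ ε * (2 * q.2 - s ^ 2) + 0 - 2 * n * ε := by
    have : 0 ≤ ε * (2 * q.2 - s ^ 2 + 2 * ρ + 1) := by
      apply mul_nonneg hε0.le; linarith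
    linarith
  have h6 : 10 * δ = G 0 - ℓ 0 := by rw [hδ]; ring
  linarith

lemma Dh_translate {n : ℕ} (u : EuclideanSpace ℝ (Fin n) × ℝ → ℝ) (s : ℝ)
    (z q : EuclideanSpace ℝ (Fin n) × ℝ) :
    Dh (fun y => u (z + y)) s q = Dh u s (z + q) := by
  unfold Dh
  have h1 : ∀ a b, z + (a, b) = (z.1 + a, z.2 + b) := fun a b => rfl
  simp only [h1, add_sub_assoc, add_assoc]

lemma approx_translates {n : ℕ} (u g φ : EuclideanSpace ℝ (Fin n) × ℝ → ℝ)
    (hu : Continuous u) (hg : Continuous g) (hφ : Continuous φ) (hφ0 : ∀ z, 0 ≤ φ z)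
    (ρ r : ℝ) (hρ : 0 < ρ)
    (hφB : ∀ z, z ∉ Metric.closedBall 0 ρ → φ z = 0)
    (hD : ∀ z, φ z ≠ 0 → ∀ q ∈ Metric.ball 0 r, ∀ ε > 0,
      ∀ᶠ s in 𝓝[>] (0:ℝ), g (z + q) - ε ≤ Dh u s (z + q)) :
    ∃ c > 0, ∀ η > 0, ∃ w h : EuclideanSpace ℝ (Fin n) × ℝ → ℝ,
      ContinuousOn w (Metric.closedBall 0 r) ∧
      (∀ q ∈ Metric.closedBall 0 r, |w q - c * ∫ z, φ z * u (z + q)| ≤ η) ∧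
      (∀ q ∈ Metric.closedBall 0 r, |h q - c * ∫ z, φ z * g (z + q)| ≤ η) ∧
      (∀ q ∈ Metric.ball 0 r, ∀ ε > 0, ∀ᶠ s in 𝓝[>] (0:ℝ), h q - ε ≤ Dh w s q) := by
  let W := EuclideanSpace ℝ (Fin n) × ℝ
  let K : Set W := Metric.closedBall 0 r
  let B : Set W := Metric.closedBall 0 ρ
  have : CompactSpace K := isCompact_iff_compactSpace.1 (isCompact_closedBall _ _)
  let S : Set (C(K, ℝ) × C(K, ℝ)) := {P | ∃ w h : W → ℝ, Continuous w ∧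
    (∀ k : K, P.1 k = w k) ∧ (∀ k : K, P.2 k = h k) ∧
    (∀ q ∈ Metric.ball (0:W) r, ∀ ε > 0, ∀ᶠ s in 𝓝[>] (0:ℝ), h q - ε ≤ Dh w s q)}
  have hS : Convex ℝ S := by
    rintro P ⟨w, h, hwc, hw, hh, hd⟩ P' ⟨w', h', hwc', hw', hh', hd'⟩ a b ha hb hab
    refine ⟨fun z => a * w z + b * w' z, fun z => a * h z + b * h' z,
      (hwc.const_mul a).add (hwc'.const_mul b), ?_, ?_, ?_⟩
    · intro k; simp [hw, hw']
    · intro k; simp [hh, hh']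
    · intro q hq ε hε
      filter_upwards [hd q hq ε hε, hd' q hq ε hε] with s h1 h2
      rw [Dh_add, Dh_smul, Dh_smul]
      have : ε = a * ε + b * ε := by rw [← add_mul, hab, one_mul]
      nlinarith [mul_le_mul_of_nonneg_left h1 ha, mul_le_mul_of_nonneg_left h2 hb]
  let tr : (v : W → ℝ) → Continuous v → C(W, C(K, ℝ)) := fun v hv =>
    ContinuousMap.curry ⟨fun p : W × K => φ p.1 * v (p.1 + p.2), by fun_prop⟩
  have htr : ∀ v (hv : Continuous v) z (k : K), tr v hv z k = φ z * v (z + k) := fun v hv z k => rfl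
  let f : W → C(K, ℝ) × C(K, ℝ) := fun z => (tr u hu z, tr g hg z)
  have hfc : Continuous f := (tr u hu).continuous.prodMk (tr g hg).continuous
  have hfS : ∀ z, f z ∈ S := by
    intro z
    refine ⟨fun q => φ z * u (z + q), fun q => φ z * g (z + q), by fun_prop, fun k => rfl,
      fun k => rfl, ?_⟩
    intro q hq ε hε
    rw [show (fun q => φ z * u (z + q)) = fun q => φ z * (fun y => u (z + y)) q from rfl]
    simp only [Dh_smul, Dh_translate]
    by_cases h0 : φ z = 0
    · simp [h0, hε.le]
    · have hpos : 0 < φ z := lt_of_le_of_ne (hφ0 z) (Ne.symm h0)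
      filter_upwards [hD z h0 q hq (ε / φ z) (by positivity)] with s hs
      have := mul_le_mul_of_nonneg_left hs hpos.le
      rw [mul_sub, mul_div_cancel₀ _ h0] at this
      exact this
  have hB0 : volume B ≠ 0 := (Metric.measure_closedBall_pos volume (0:W) hρ).ne'
  have hBt : volume B ≠ ⊤ := (isCompact_closedBall (0:W) ρ).measure_lt_top.ne
  have hfi : IntegrableOn f B volume := hfc.continuousOn.integrableOn_compact (isCompact_closedBall _ _)
  have hav := hS.set_average_mem_closure (t := B) (f := f) hB0 hBt
    (Eventually.of_forall hfS) hfi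
  rw [setAverage_eq] at hav
  have hcpos : 0 < (volume.real B)⁻¹ := inv_pos.2 (ENNReal.toReal_pos hB0 hBt)
  refine ⟨(volume.real B)⁻¹, hcpos, fun η hη => ?_⟩
  obtain ⟨P, ⟨w, h, hwc, hw, hh, hd⟩, hdist⟩ := Metric.mem_closure_iff.1 hav η hη
  have full : ∀ v : W → ℝ, ∀ q, ∫ z in B, φ z * v (z + q) = ∫ z, φ z * v (z + q) := by
    intro v q
    apply setIntegral_eq_integral_of_forall_compl_eq_zero
    intro z hz
    rw [hφB z hz, zero_mul]
  have ev1 : ∀ k : K, ((volume.real B)⁻¹ • ∫ z in B, f z).1 k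
      = (volume.real B)⁻¹ * ∫ z, φ z * u (z + k) := by
    intro k
    have := ((ContinuousMap.evalCLM ℝ k).comp
      (ContinuousLinearMap.fst ℝ C(K, ℝ) C(K, ℝ))).integral_comp_comm hfi
    rw [← full]
    simp only [Prod.smul_fst, ContinuousMap.smul_apply, smul_eq_mul]
    congr 1
    exact this.symm
  have ev2 : ∀ k : K, ((volume.real B)⁻¹ • ∫ z in B, f z).2 k
      = (volume.real B)⁻¹ * ∫ z, φ z * g (z + k) := by
    intro k
    have := ((ContinuousMap.evalCLM ℝ k).comp
      (ContinuousLinearMap.snd ℝ C(K, ℝ) C(K, ℝ))).integral_comp_comm hfi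
    rw [← full]
    simp only [Prod.smul_snd, ContinuousMap.smul_apply, smul_eq_mul]
    congr 1
    exact this.symm
  rw [dist_comm, Prod.dist_eq, max_lt_iff] at hdist
  refine ⟨w, h, hwc.continuousOn, ?_, ?_, hd⟩
  · intro q hq
    have := (ContinuousMap.dist_apply_le_dist (f := P.1) (⟨q, hq⟩ : K)).trans hdist.1.le
    rw [ev1, hw, Real.dist_eq] at this
    exact this
  · intro q hq
    have := (ContinuousMap.dist_apply_le_dist (f := P.2) (⟨q, hq⟩ : K)).trans hdist.2.le
    rw [ev2, hh, Real.dist_eq] at this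
    exact this

lemma vol_haar (n : ℕ) :
    (volume : Measure (EuclideanSpace ℝ (Fin n) × ℝ)).IsAddHaarMeasure :=
  inferInstanceAs ((volume : Measure (EuclideanSpace ℝ (Fin n))).prod
    (volume : Measure ℝ)).IsAddHaarMeasure

lemma fderiv_neg_arg {n : ℕ} (f : EuclideanSpace ℝ (Fin n) × ℝ → ℝ) (hf : Differentiable ℝ f)
    (z v) : fderiv ℝ (fun y => f (-y)) z v = - fderiv ℝ f (-z) v := by
  have h := (hf (-z)).hasFDerivAt.comp z ((hasFDerivAt_id z).neg)
  have h2 : fderiv ℝ (fun y => f (-y)) z = _ := h.fderiv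
  rw [h2]
  simp

lemma conv_fderiv {n : ℕ} (u ψ : EuclideanSpace ℝ (Fin n) × ℝ → ℝ) (hu : Continuous u)
    (hψ : ContDiff ℝ 1 ψ) (hc : HasCompactSupport ψ) (v : EuclideanSpace ℝ (Fin n) × ℝ) (q) :
    ∃ T : EuclideanSpace ℝ (Fin n) × ℝ →L[ℝ] ℝ, HasFDerivAt (fun q => ∫ z, u z * ψ (q - z)) T q ∧
      T v = ∫ z, u z * fderiv ℝ ψ (q - z) v := by
  have := vol_haar n
  have h := hc.hasFDerivAt_convolution_right (μ := volume) (ContinuousLinearMap.mul ℝ ℝ)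
    hu.locallyIntegrable hψ q
  refine ⟨_, h, ?_⟩
  rw [convolution_precompR_apply (ContinuousLinearMap.mul ℝ ℝ) hu.locallyIntegrable (hc.fderiv ℝ)
    (hψ.continuous_fderiv one_ne_zero)]
  rfl

lemma conv_cont {n : ℕ} (u ψ : EuclideanSpace ℝ (Fin n) × ℝ → ℝ) (hu : Continuous u)
    (hψ : Continuous ψ) (hc : HasCompactSupport ψ) :
    Continuous (fun q => ∫ z, u z * ψ (q - z)) :=
  hc.continuous_convolution_right (μ := volume) (ContinuousLinearMap.mul ℝ ℝ)
    hu.locallyIntegrable hψ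

lemma hcs_dir {n : ℕ} (ψ : EuclideanSpace ℝ (Fin n) × ℝ → ℝ) (hc : HasCompactSupport ψ)
    (v : EuclideanSpace ℝ (Fin n) × ℝ) : HasCompactSupport (fun y => fderiv ℝ ψ y v) :=
  (hc.fderiv ℝ).comp_left (g := fun T : EuclideanSpace ℝ (Fin n) × ℝ →L[ℝ] ℝ => T v) rfl

lemma contDiff_dir {n : ℕ} (ψ : EuclideanSpace ℝ (Fin n) × ℝ → ℝ) (hψ : ContDiff ℝ 2 ψ)
    (v : EuclideanSpace ℝ (Fin n) × ℝ) : ContDiff ℝ 1 (fun y => fderiv ℝ ψ y v) :=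
  (hψ.fderiv_right (m := 1) (by norm_num)).clm_apply contDiff_const

lemma conv_Dh {n : ℕ} (u ψ : EuclideanSpace ℝ (Fin n) × ℝ → ℝ) (hu : Continuous u)
    (hψ : ContDiff ℝ 2 ψ) (hc : HasCompactSupport ψ) (q : EuclideanSpace ℝ (Fin n) × ℝ) :
    Tendsto (fun s => Dh (fun q => ∫ z, u z * ψ (q - z)) s q) (𝓝[>] 0)
      (𝓝 ((∫ z, u z * fderiv ℝ ψ (q - z) (0, 1)) - ∑ i, ∫ z, u z *
        fderiv ℝ (fun y => fderiv ℝ ψ y (EuclideanSpace.single i 1, 0)) (q - z)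
          (EuclideanSpace.single i 1, 0))) := by
  have hψ1 : ContDiff ℝ 1 ψ := hψ.of_le (by norm_num)
  -- derivative along a line
  have line : ∀ (χ : EuclideanSpace ℝ (Fin n) × ℝ → ℝ), ContDiff ℝ 1 χ → HasCompactSupport χ →
      ∀ (i : Fin n) (s : ℝ), HasDerivAt (fun s : ℝ => (fun q => ∫ z, u z * χ (q - z))
        (q.1 + s • EuclideanSpace.single i 1, q.2))
        (∫ z, u z * fderiv ℝ χ ((q.1 + s • EuclideanSpace.single i 1, q.2) - z)
          (EuclideanSpace.single i 1, 0)) s := by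
    intro χ hχ hχc i s
    obtain ⟨T, h1, h2⟩ := conv_fderiv u χ hu hχ hχc (EuclideanSpace.single i 1, 0)
      (q.1 + s • EuclideanSpace.single i 1, q.2)
    rw [← h2]
    refine HasFDerivAt.comp_hasDerivAt
      (f := fun s : ℝ => (q.1 + s • EuclideanSpace.single i (1:ℝ), q.2)) s h1 ?_
    apply HasDerivAt.prodMk
    · simpa using ((hasDerivAt_id s).smul_const (EuclideanSpace.single i (1:ℝ))).const_add q.1
    · exact hasDerivAt_const s q.2
  apply Dh_tendsto
  · obtain ⟨T, h1, h2⟩ := conv_fderiv u ψ hu hψ1 hc (0, 1) q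
    rw [← h2]
    exact HasFDerivAt.comp_hasDerivAt (f := fun t : ℝ => (q.1, t)) q.2 h1
      ((hasDerivAt_const q.2 q.1).prodMk (hasDerivAt_id q.2))
  · intro i
    refine ⟨_, line ψ hψ1 hc i, ?_⟩
    have := line _ (contDiff_dir ψ hψ (EuclideanSpace.single i 1, 0))
      (hcs_dir ψ hc _) i 0
    simpa using this

lemma weak_ineq {n : ℕ} (u g φ : EuclideanSpace ℝ (Fin n) × ℝ → ℝ)
    (hu : Continuous u) (hg : Continuous g) (hφ : ContDiff ℝ 2 φ) (hφ0 : ∀ z, 0 ≤ φ z)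
    (hc : HasCompactSupport φ) (Ω : Set (EuclideanSpace ℝ (Fin n) × ℝ)) (hΩ : IsOpen Ω)
    (hsub : tsupport φ ⊆ Ω)
    (hD : ∀ q ∈ Ω, ∀ ε > 0, ∀ᶠ s in 𝓝[>] (0:ℝ), g q - ε ≤ Dh u s q) :
    ∫ z, φ z * g z ≤ ∫ z, u z * (-fderiv ℝ φ z (0, 1) - ∑ i,
      fderiv ℝ (fun y => fderiv ℝ φ y (EuclideanSpace.single i 1, 0)) z
          (EuclideanSpace.single i 1, 0)) := by
  have := vol_haar n
  set ψ : EuclideanSpace ℝ (Fin n) × ℝ → ℝ := fun y => φ (-y) with hψdef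
  have hψ : ContDiff ℝ 2 ψ := hφ.comp contDiff_neg
  have hψ1 : ContDiff ℝ 1 ψ := hψ.of_le (by norm_num)
  have hψc : HasCompactSupport ψ := hc.comp_homeomorph (Homeomorph.neg _)
  have hconv : ∀ v : EuclideanSpace ℝ (Fin n) × ℝ → ℝ, ∀ q,
      ∫ z, φ z * v (z + q) = ∫ z, v z * ψ (q - z) := by
    intro v q
    rw [← integral_add_right_eq_self (fun z => v z * ψ (q - z)) q]
    congr 1
    ext z
    simp [hψdef, mul_comm]
  obtain ⟨r, hr, hrs⟩ := hc.isCompact.exists_cthickening_subset_open hΩ hsub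
  obtain ⟨ρ, hρ0, hρ⟩ := hc.isCompact.isBounded.subset_closedBall_lt 0 0
  obtain ⟨c, hc0, happ⟩ := approx_translates u g φ hu hg hφ.continuous hφ0 ρ r hρ0
    (fun z hz => image_eq_zero_of_notMem_tsupport (fun h => hz (hρ h))) (by
      intro z hz q hq
      apply hD
      apply hrs
      apply Metric.mem_cthickening_of_dist_le (z + q) z r _ (subset_tsupport _ hz)
      simp only [dist_self_add_left]
      simpa using (Metric.mem_ball.1 hq).le)
  have hUD := conv_Dh u ψ hu hψ hψc
  set ℓ : EuclideanSpace ℝ (Fin n) × ℝ → ℝ := fun q =>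
    ((∫ z, u z * fderiv ℝ ψ (q - z) (0, 1)) - ∑ i, ∫ z, u z *
        fderiv ℝ (fun y => fderiv ℝ ψ y (EuclideanSpace.single i 1, 0)) (q - z)
          (EuclideanSpace.single i 1, 0)) with hℓ
  have hdc : ∀ v, Continuous (fun y => fderiv ℝ ψ y v) := fun v => (contDiff_dir ψ hψ v).continuous
  have hdcc : ∀ v, Continuous (fun z => fderiv ℝ (fun y => fderiv ℝ ψ y v) z v) := fun v =>
    ((contDiff_dir ψ hψ v).continuous_fderiv one_ne_zero).clm_apply continuous_const
  have hℓc : Continuous ℓ := by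
    apply (conv_cont u _ hu (hdc _) (hcs_dir ψ hψc _)).sub
    apply continuous_finsetSum
    intro i _
    exact conv_cont u _ hu (hdcc _) (hcs_dir _ (hcs_dir ψ hψc _) _)
  have hst := stability r hr (fun q => c * ∫ z, φ z * u (z + q)) (fun q => c * ℓ q)
    (fun q => c * ∫ z, φ z * g (z + q)) ?_ ?_ ?_ ?_ happ
  · have h1 := le_of_mul_le_mul_left hst hc0
    simp only [add_zero] at h1
    refine h1.trans (le_of_eq ?_)
    rw [hℓ]
    simp only [zero_sub]
    have f1 : ∀ v z, fderiv ℝ ψ z v = - fderiv ℝ φ (-z) v := by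
      intro v z
      exact fderiv_neg_arg φ (hφ.differentiable (by norm_num)) z v
    have f2 : ∀ v z, fderiv ℝ (fun y => fderiv ℝ ψ y v) (-z) v
        = fderiv ℝ (fun y => fderiv ℝ φ y v) z v := by
      intro v z
      have : (fun y => fderiv ℝ ψ y v) = fun y => - (fun y => fderiv ℝ φ y v) (-y) := by
        ext y; exact f1 v y
      rw [this, fderiv_fun_neg]
      have h3 := fderiv_neg_arg _ ((contDiff_dir φ hφ v).differentiable (by norm_num)) (-z) v
      simp only [neg_neg] at h3
      simp only [neg_apply, h3, neg_neg]
    simp only [f2]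
    simp only [f1, neg_neg]
    have i1 : ∀ χ : EuclideanSpace ℝ (Fin n) × ℝ → ℝ, Continuous χ → HasCompactSupport χ →
        Integrable (fun z => u z * χ z) := fun χ h1 h2 =>
      (hu.mul h1).integrable_of_hasCompactSupport h2.mul_left
    have d1 : ∀ v, Continuous (fun y => fderiv ℝ φ y v) := fun v => (contDiff_dir φ hφ v).continuous
    have d2 : ∀ v, Continuous (fun z => fderiv ℝ (fun y => fderiv ℝ φ y v) z v) := fun v =>
      ((contDiff_dir φ hφ v).continuous_fderiv one_ne_zero).clm_apply continuous_const
    simp only [mul_sub, Finset.mul_sum]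
    rw [integral_sub, integral_finsetSum]
    · intro i _
      exact i1 _ (d2 _) (hcs_dir _ (hcs_dir φ hc _) _)
    · exact i1 _ (d1 _).neg (hcs_dir φ hc _).neg
    · apply integrable_finsetSum
      intro i _
      exact i1 _ (d2 _) (hcs_dir _ (hcs_dir φ hc _) _)
  · simp only [hconv]
    exact (conv_cont u ψ hu hψ.continuous hψc).const_mul c
  · exact (hℓc.const_mul c).continuousAt
  · simp only [hconv]
    exact ((conv_cont g ψ hg hψ.continuous hψc).const_mul c).continuousAt
  · intro q
    simp only [hconv]
    simp only [Dh_smul]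
    exact (hUD q).const_mul c

lemma hasDerivAt_posPart_pow (k : ℕ) (h : ℝ) :
    HasDerivAt (fun h : ℝ => (max h 0) ^ (k + 2)) ((k + 2) * (max h 0) ^ (k + 1)) h := by
  rcases lt_trichotomy h 0 with hh | hh | hh
  · have e : (fun h : ℝ => (max h 0) ^ (k + 2)) =ᶠ[𝓝 h] fun _ => 0 := by
      filter_upwards [gt_mem_nhds hh] with y hy
      rw [max_eq_right hy.le]; simp
    rw [max_eq_right hh.le]
    simpa using (hasDerivAt_const h (0:ℝ)).congr_of_eventuallyEq e
  · subst hh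
    rw [hasDerivAt_iff_isLittleO]
    simp only [max_self, ne_eq, Nat.add_eq_zero_iff, one_ne_zero, and_false, not_false_eq_true,
      zero_pow, OfNat.ofNat_ne_zero, sub_zero, mul_zero, smul_zero]
    have h1 : (fun x : ℝ => x ^ (k + 2)) =o[𝓝 0] (fun x : ℝ => x) := by
      simpa using Asymptotics.isLittleO_pow_pow (𝕜 := ℝ) (show 1 < k + 2 by omega)
    refine Asymptotics.IsBigO.trans_isLittleO ?_ h1
    apply Asymptotics.IsBigO.of_bound 1
    filter_upwards with x
    rw [one_mul, norm_pow, norm_pow]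
    apply pow_le_pow_left₀ (norm_nonneg _)
    rw [Real.norm_eq_abs, Real.norm_eq_abs, abs_of_nonneg (le_max_right _ _)]
    exact max_le (le_abs_self x) (abs_nonneg x)
  · have e : (fun h : ℝ => (max h 0) ^ (k + 2)) =ᶠ[𝓝 h] fun y => y ^ (k + 2) := by
      filter_upwards [lt_mem_nhds hh] with y hy
      rw [max_eq_left hy.le]
    rw [max_eq_left hh.le]
    have := (hasDerivAt_pow (k + 2) h).congr_of_eventuallyEq e
    exact this.congr_deriv (by push_cast; congr 1)

lemma contDiff_posPart_cube : ContDiff ℝ 2 (fun h : ℝ => (max h 0) ^ 3) := by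
  have d1 : deriv (fun h : ℝ => (max h 0) ^ 3) = fun h => 3 * (max h 0) ^ 2 := by
    ext h
    rw [(hasDerivAt_posPart_pow 1 h).deriv]; norm_num
  have d2 : deriv (fun h : ℝ => 3 * (max h 0) ^ 2) = fun h => 3 * (2 * (max h 0)) := by
    ext h
    rw [((hasDerivAt_posPart_pow 0 h).const_mul 3).deriv]; norm_num
  rw [show (2 : WithTop ℕ∞) = 1 + 1 by norm_num, contDiff_succ_iff_deriv]
  refine ⟨fun h => (hasDerivAt_posPart_pow 1 h).differentiableAt, by simp, ?_⟩
  rw [d1, contDiff_one_iff_deriv, d2]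
  exact ⟨fun h => ((hasDerivAt_posPart_pow 0 h).const_mul 3).differentiableAt, by fun_prop⟩

lemma fderiv_of_line {n : ℕ} (F : EuclideanSpace ℝ (Fin n) × ℝ → ℝ)
    (z v : EuclideanSpace ℝ (Fin n) × ℝ) (d : ℝ) (hF : DifferentiableAt ℝ F z)
    (h : HasDerivAt (fun s : ℝ => F (z + s • v)) d 0) : fderiv ℝ F z v = d := by
  rw [← hF.lineDeriv_eq_fderiv]
  exact HasLineDerivAt.lineDeriv h

/-- The parabolic height function. -/
noncomputable def hgt {n : ℕ} (x₀ : EuclideanSpace ℝ (Fin n)) (R : ℝ)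
    (x : EuclideanSpace ℝ (Fin n)) : ℝ := 1 - ‖x - x₀‖ ^ 2 / R ^ 2

lemma hgt_line {n : ℕ} (x₀ x : EuclideanSpace ℝ (Fin n)) (R s : ℝ) (i : Fin n) :
    hgt x₀ R (x + s • EuclideanSpace.single i 1)
      = hgt x₀ R x - (2 * s * (x i - x₀ i) + s ^ 2) / R ^ 2 := by
  unfold hgt
  have : x + s • EuclideanSpace.single i (1:ℝ) - x₀
      = (x - x₀) + s • EuclideanSpace.single i (1:ℝ) := by abel
  rw [this, norm_add_sq_real]
  have h2 : ‖s • EuclideanSpace.single i (1:ℝ)‖ ^ 2 = s ^ 2 := by simp [norm_smul]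
  have h3 : inner ℝ (x - x₀) (s • EuclideanSpace.single i (1:ℝ)) = s * (x i - x₀ i) := by
    rw [inner_smul_right, EuclideanSpace.inner_single_right]; simp
  rw [h2, h3]
  ring

lemma test_derivs {n : ℕ} (x₀ : EuclideanSpace ℝ (Fin n)) (R : ℝ) (hR : 0 < R) (T T' : ℝ → ℝ)
    (hT : ContDiff ℝ 2 T) (hT' : ∀ t, HasDerivAt T (T' t) t) :
    ContDiff ℝ 2 (fun z : EuclideanSpace ℝ (Fin n) × ℝ => T z.2 * (max (hgt x₀ R z.1) 0) ^ 3) ∧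
    ∀ z : EuclideanSpace ℝ (Fin n) × ℝ,
      fderiv ℝ (fun z : EuclideanSpace ℝ (Fin n) × ℝ => T z.2 * (max (hgt x₀ R z.1) 0) ^ 3) z (0, 1)
        = T' z.2 * (max (hgt x₀ R z.1) 0) ^ 3 ∧
      ∑ i, fderiv ℝ (fun y => fderiv ℝ (fun z : EuclideanSpace ℝ (Fin n) × ℝ =>
          T z.2 * (max (hgt x₀ R z.1) 0) ^ 3) y (EuclideanSpace.single i 1, 0)) z
          (EuclideanSpace.single i 1, 0)
        = T z.2 * ((24 * (max (hgt x₀ R z.1) 0) * (1 - hgt x₀ R z.1)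
            - 6 * n * (max (hgt x₀ R z.1) 0) ^ 2) / R ^ 2) := by
  set φ := fun z : EuclideanSpace ℝ (Fin n) × ℝ => T z.2 * (max (hgt x₀ R z.1) 0) ^ 3 with hφdef
  have hh : ContDiff ℝ 2 (fun z : EuclideanSpace ℝ (Fin n) × ℝ => hgt x₀ R z.1) := by
    unfold hgt
    exact contDiff_const.sub (((contDiff_fst.sub contDiff_const).norm_sq ℝ).div_const _)
  have hφ : ContDiff ℝ 2 φ :=
    (hT.comp contDiff_snd).mul (contDiff_posPart_cube.comp hh)
  refine ⟨hφ, fun z => ⟨?_, ?_⟩⟩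
  · apply fderiv_of_line _ _ _ _ (hφ.differentiable (by norm_num) z)
    have : (fun s : ℝ => φ (z + s • (0, 1)))
        = fun s : ℝ => T (z.2 + s) * (max (hgt x₀ R z.1) 0) ^ 3 := by
      ext s; simp [hφdef]
    rw [this]
    apply HasDerivAt.mul_const
    apply HasDerivAt.comp_const_add
    simpa using hT' z.2
  · have line : ∀ (x : EuclideanSpace ℝ (Fin n)) (i : Fin n), HasDerivAt
        (fun s : ℝ => hgt x₀ R (x + s • EuclideanSpace.single i 1)) (-2 * (x i - x₀ i) / R ^ 2) 0 := by
      intro x i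
      simp only [hgt_line]
      have h1 : HasDerivAt (fun s : ℝ => 2 * s * (x i - x₀ i) + s ^ 2)
          (2 * (x i - x₀ i)) 0 := by
        have := (((hasDerivAt_id (0:ℝ)).const_mul 2).mul_const (x i - x₀ i)).add
          (hasDerivAt_pow 2 (0:ℝ))
        exact this.congr_deriv (by simp)
      exact ((h1.div_const (R ^ 2)).const_sub (hgt x₀ R x)).congr_deriv (by ring)
    have pt : ∀ (z : EuclideanSpace ℝ (Fin n) × ℝ) (i : Fin n) (s : ℝ),
        z + s • ((EuclideanSpace.single i 1 : EuclideanSpace ℝ (Fin n)), (0:ℝ))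
        = (z.1 + s • EuclideanSpace.single i 1, z.2) := by
      intro z i s
      ext <;> simp
    have first : ∀ i, (fun y => fderiv ℝ φ y (EuclideanSpace.single i 1, 0)) = fun y =>
        T y.2 * (3 * (max (hgt x₀ R y.1) 0) ^ 2 * (-2 * (y.1 i - x₀ i) / R ^ 2)) := by
      intro i
      ext y
      apply fderiv_of_line _ _ _ _ (hφ.differentiable (by norm_num) y)
      simp only [pt, hφdef]
      apply HasDerivAt.const_mul
      have h2 := hasDerivAt_posPart_pow 1 (hgt x₀ R (y.1 + (0:ℝ) • EuclideanSpace.single i 1))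
      have h3 := h2.comp (0:ℝ) (line y.1 i)
      refine h3.congr_deriv ?_
      simp
      left; norm_num
    have second : ∀ i, fderiv ℝ (fun y => fderiv ℝ φ y (EuclideanSpace.single i 1, 0)) z
        (EuclideanSpace.single i 1, 0) = T z.2 * (
          24 * (max (hgt x₀ R z.1) 0) * ((z.1 - x₀) i) ^ 2 / R ^ 4
            - 6 * (max (hgt x₀ R z.1) 0) ^ 2 / R ^ 2) := by
      intro i
      apply fderiv_of_line _ _ _ _ ((contDiff_dir φ hφ _).differentiable (by norm_num) z)
      have first' := fun y => congrFun (first i) y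
      simp only [first', pt]
      apply HasDerivAt.const_mul
      have h2 := hasDerivAt_posPart_pow 0 (hgt x₀ R (z.1 + (0:ℝ) • EuclideanSpace.single i 1))
      have h3 := (h2.comp (0:ℝ) (line z.1 i)).const_mul 3
      have h4 : HasDerivAt (fun s : ℝ => -2 * ((z.1 + s • EuclideanSpace.single i (1:ℝ)).ofLp i
          - x₀ i) / R ^ 2) (-2 / R ^ 2) 0 := by
        have : (fun s : ℝ => -2 * ((z.1 + s • EuclideanSpace.single i (1:ℝ)).ofLp i
          - x₀ i) / R ^ 2) = fun s : ℝ => (-2 / R ^ 2) * s + (-2 * (z.1 i - x₀ i) / R ^ 2) := by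
          ext s
          simp
          ring
        rw [this]
        simpa using ((hasDerivAt_id (0:ℝ)).const_mul (-2 / R ^ 2)).add_const
          (-2 * (z.1 i - x₀ i) / R ^ 2)
      refine (h3.mul h4).congr_deriv ?_
      simp
      field_simp
      ring
    simp only [second]
    rw [← Finset.mul_sum, Finset.sum_sub_distrib, ← Finset.sum_div, ← Finset.mul_sum,
      ← EuclideanSpace.real_norm_sq_eq]
    congr 1
    simp only [Finset.sum_const, Finset.card_univ, Fintype.card_fin, nsmul_eq_mul]
    have : 1 - hgt x₀ R z.1 = ‖z.1 - x₀‖ ^ 2 / R ^ 2 := by unfold hgt; ring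
    rw [this]
    field_simp

lemma lap_lower (n : ℕ) (h : ℝ) :
    -(((24 + 6 * n : ℝ)) ^ 2 / 96) * (max h 0) ^ 3
      ≤ 24 * (max h 0) * (1 - h) - 6 * n * (max h 0) ^ 2 := by
  rcases le_total h 0 with h0 | h0
  · rw [max_eq_right h0]; simp
  · rw [max_eq_left h0]
    have : 0 ≤ h * (24 - (24 + 6 * n) * h + ((24 + 6 * n : ℝ)) ^ 2 / 96 * h ^ 2) := by
      apply mul_nonneg h0
      nlinarith [sq_nonneg ((24 + 6 * n : ℝ) * h / 2 - 24)]
    nlinarith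

lemma smoothTransition_deriv_bound : ∃ C > 0, ∀ x, |deriv Real.smoothTransition x| ≤ C := by
  have hc : Continuous (deriv Real.smoothTransition) :=
    (Real.smoothTransition.contDiff (n := 1)).continuous_deriv (by norm_num)
  obtain ⟨C, hC⟩ := (isCompact_Icc (a := (0:ℝ)) (b := 1)).exists_bound_of_continuousOn hc.continuousOn
  refine ⟨max C 1, by positivity, fun x => ?_⟩
  by_cases hx : x ∈ Icc (0:ℝ) 1
  · exact (hC x hx).trans (le_max_left _ _)
  · have : deriv Real.smoothTransition x = 0 := by
      rw [mem_Icc, not_and_or, not_le, not_le] at hx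
      rcases hx with hx | hx
      · have e : Real.smoothTransition =ᶠ[𝓝 x] fun _ => 0 := by
          filter_upwards [gt_mem_nhds hx] with y hy
          exact Real.smoothTransition.zero_of_nonpos hy.le
        rw [e.deriv_eq]; simp
      · have e : Real.smoothTransition =ᶠ[𝓝 x] fun _ => 1 := by
          filter_upwards [lt_mem_nhds hx] with y hy
          exact Real.smoothTransition.one_of_one_le hy.le
        rw [e.deriv_eq]; simp
    rw [this]; simp

lemma time_fun (p Λ : ℝ) (hp : 1 < p) (hΛ : 0 ≤ Λ) : ∃ c > 0, ∀ δ > 0, ∀ R > 0,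
    ∃ T T' : ℝ → ℝ, ContDiff ℝ 2 T ∧ (∀ t, HasDerivAt T (T' t) t) ∧ (∀ t, 0 ≤ T t) ∧
      (∀ t, T t ≤ Real.exp Λ) ∧ (∀ t, t ≤ 2 * δ → T t = 0) ∧ (∀ t, R ^ 2 ≤ t → T t = 0) ∧
      (∀ t, 3 * δ ≤ t → t ≤ R ^ 2 / 4 → 1 ≤ T t) ∧
      (∀ t, t ≤ R ^ 2 / 4 → Λ / R ^ 2 * T t ≤ T' t) ∧
      (∀ t, Λ / R ^ 2 * T t - c / R ^ 2 * (T t) ^ (1 / p) ≤ T' t) := by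
  obtain ⟨C, hC0, hC⟩ := smoothTransition_deriv_bound
  obtain ⟨k, hk⟩ := exists_nat_ge (1 / (p - 1))
  have hk0 : 0 < (k:ℝ) := lt_of_lt_of_le (by apply one_div_pos.2; linarith) hk
  have hk1 : k ≠ 0 := by rintro rfl; simp at hk0
  have hkp : (k:ℝ) + 1 ≤ k * p := by
    rw [div_le_iff₀ (by linarith)] at hk
    linarith
  refine ⟨(k + 1) * (4 / 3 * C) * Real.exp Λ, by positivity, fun δ hδ R hR => ?_⟩
  set χ : ℝ → ℝ := fun t => Real.smoothTransition (t / δ - 2) with hχ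
  set η : ℝ → ℝ := fun t => 1 - Real.smoothTransition ((4 * (t / R ^ 2) - 1) / 3) with hη
  set E : ℝ → ℝ := fun t => Real.exp (Λ / R ^ 2 * t) with hE
  set dχ : ℝ → ℝ := fun t => deriv Real.smoothTransition (t / δ - 2) * (1 / δ) with hdχ
  set dη : ℝ → ℝ := fun t =>
    -(deriv Real.smoothTransition ((4 * (t / R ^ 2) - 1) / 3) * (4 / R ^ 2 / 3)) with hdη
  have hst : ∀ x, HasDerivAt Real.smoothTransition (deriv Real.smoothTransition x) x := fun x =>
    ((Real.smoothTransition.contDiff (n := 1)).differentiable (by norm_num) x).hasDerivAt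
  have hst0 : ∀ x, 0 ≤ deriv Real.smoothTransition x := fun x => Real.smoothTransition.monotone.deriv_nonneg
  have Dχ : ∀ t, HasDerivAt χ (dχ t) t := by
    intro t
    have h1 : HasDerivAt (fun t : ℝ => t / δ - 2) (1 / δ) t :=
      ((hasDerivAt_id t).div_const δ).sub_const 2
    exact (hst _).comp t h1
  have Dη : ∀ t, HasDerivAt η (dη t) t := by
    intro t
    have h1 : HasDerivAt (fun t : ℝ => (4 * (t / R ^ 2) - 1) / 3) (4 / R ^ 2 / 3) t := by
      have := (((((hasDerivAt_id t).div_const (R ^ 2)).const_mul 4).sub_const 1).div_const 3)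
      exact this.congr_deriv (by ring)
    exact ((hst _).comp t h1).const_sub 1
  have DE : ∀ t, HasDerivAt E (E t * (Λ / R ^ 2)) t := by
    intro t
    have := ((hasDerivAt_id t).const_mul (Λ / R ^ 2)).exp
    exact this.congr_deriv (by simp [hE])
  have cχ : ContDiff ℝ 2 χ := (Real.smoothTransition.contDiff (n := 2)).comp (by fun_prop)
  have cη : ContDiff ℝ 2 η :=
    contDiff_const.sub ((Real.smoothTransition.contDiff (n := 2)).comp (by fun_prop))
  have cE : ContDiff ℝ 2 E := by rw [hE]; fun_prop
  have χ0 : ∀ t, 0 ≤ χ t := fun t => Real.smoothTransition.nonneg _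
  have χ1 : ∀ t, χ t ≤ 1 := fun t => Real.smoothTransition.le_one _
  have η0 : ∀ t, 0 ≤ η t := fun t => sub_nonneg.2 (Real.smoothTransition.le_one _)
  have η1 : ∀ t, η t ≤ 1 := fun t => by
    have := Real.smoothTransition.nonneg ((4 * (t / R ^ 2) - 1) / 3)
    simp only [hη]; linarith
  have E0 : ∀ t, 0 < E t := fun t => Real.exp_pos _
  have χz : ∀ t, t ≤ 2 * δ → χ t = 0 := by
    intro t ht
    apply Real.smoothTransition.zero_of_nonpos
    have : t / δ ≤ 2 := by rw [div_le_iff₀ hδ]; exact ht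
    linarith
  have ηz : ∀ t, R ^ 2 ≤ t → η t = 0 := by
    intro t ht
    simp only [hη]
    rw [Real.smoothTransition.one_of_one_le, sub_self]
    have : 1 ≤ t / R ^ 2 := by rw [le_div_iff₀ (by positivity)]; linarith
    linarith
  have hs4 : ∀ t, t ≤ R ^ 2 / 4 → (4 * (t / R ^ 2) - 1) / 3 ≤ 0 := by
    intro t ht
    have : t / R ^ 2 ≤ 1 / 4 := by rw [div_le_iff₀ (by positivity)]; linarith
    linarith
  have ηo : ∀ t, t ≤ R ^ 2 / 4 → η t = 1 := by
    intro t ht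
    simp only [hη]
    rw [Real.smoothTransition.zero_of_nonpos (hs4 t ht), sub_zero]
  have dηz : ∀ t, t ≤ R ^ 2 / 4 → dη t = 0 := by
    intro t ht
    have h1 : IsLocalMin Real.smoothTransition ((4 * (t / R ^ 2) - 1) / 3) := by
      filter_upwards with y
      rw [Real.smoothTransition.zero_of_nonpos (hs4 t ht)]
      exact Real.smoothTransition.nonneg _
    simp only [hdη, h1.deriv_eq_zero, zero_mul, neg_zero]
  have dηb : ∀ t, -(4 / 3 * C / R ^ 2) ≤ dη t := by
    intro t
    simp only [hdη]
    have h1 := (abs_le.1 (hC ((4 * (t / R ^ 2) - 1) / 3))).2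
    have h2 : 4 / 3 * C / R ^ 2 = C * (4 / R ^ 2 / 3) := by ring
    rw [h2, neg_le_neg_iff]
    gcongr
  have dχ0 : ∀ t, 0 ≤ dχ t := fun t => mul_nonneg (hst0 _) (by positivity)
  have E1 : ∀ t, 0 ≤ t → 1 ≤ E t := fun t ht => Real.one_le_exp (by positivity)
  have Eb : ∀ t, t ≤ R ^ 2 → E t ≤ Real.exp Λ := by
    intro t ht
    apply Real.exp_le_exp.2
    rw [div_mul_eq_mul_div, div_le_iff₀ (by positivity)]
    gcongr
  set T : ℝ → ℝ := fun t => χ t * E t * η t ^ (k + 1) with hT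
  set T' : ℝ → ℝ := fun t => (dχ t * E t + χ t * (E t * (Λ / R ^ 2))) * η t ^ (k + 1)
    + χ t * E t * (((k + 1 : ℕ) : ℝ) * η t ^ k * dη t) with hT'
  have T0 : ∀ t, 0 ≤ T t := fun t =>
    mul_nonneg (mul_nonneg (χ0 t) (E0 t).le) (pow_nonneg (η0 t) _)
  -- lower bound of the derivative
  have lower : ∀ t, Λ / R ^ 2 * T t + χ t * E t * (((k + 1 : ℕ) : ℝ) * η t ^ k * dη t) ≤ T' t := by
    intro t
    have : 0 ≤ dχ t * E t * η t ^ (k + 1) :=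
      mul_nonneg (mul_nonneg (dχ0 t) (E0 t).le) (pow_nonneg (η0 t) _)
    simp only [hT, hT']
    linarith
  refine ⟨T, T', (cχ.mul cE).mul (cη.pow _), ?_, T0, ?_, ?_, ?_, ?_, ?_, ?_⟩
  · intro t
    have : HasDerivAt T _ t := ((Dχ t).mul (DE t)).mul ((Dη t).pow (k + 1))
    exact this.congr_deriv (by simp [hT'])
  · intro t
    rcases le_total t (R ^ 2) with ht | ht
    · calc T t ≤ 1 * Real.exp Λ * 1 := by
            simp only [hT]
            have := pow_le_one₀ (n := k + 1) (η0 t) (η1 t)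
            have := pow_nonneg (η0 t) (k + 1)
            have := χ0 t
            have := χ1 t
            have := Eb t ht
            have := E0 t
            gcongr
        _ = Real.exp Λ := by ring
    · simp only [hT, ηz t ht]
      simp [Real.exp_nonneg]
  · intro t ht; simp [hT, χz t ht]
  · intro t ht; simp [hT, ηz t ht]
  · intro t h1 h2
    have : χ t = 1 := by
      apply Real.smoothTransition.one_of_one_le
      have : 3 ≤ t / δ := by rw [le_div_iff₀ hδ]; exact h1
      linarith
    simp only [hT, this, ηo t h2]
    simpa using E1 t (by linarith)
  · intro t ht
    have := lower t
    rw [dηz t ht] at this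
    simpa using this
  · intro t
    refine le_trans ?_ (lower t)
    have main : χ t * E t * η t ^ k ≤ Real.exp Λ * (T t) ^ (1 / p) := by
      by_cases h1 : t ≤ 2 * δ
      · rw [χz t h1]; simp only [zero_mul]
        exact mul_nonneg (Real.exp_nonneg _) (Real.rpow_nonneg (T0 t) _)
      by_cases h2 : R ^ 2 ≤ t
      · rw [ηz t h2, zero_pow hk1, mul_zero]
        exact mul_nonneg (Real.exp_nonneg _) (Real.rpow_nonneg (T0 t) _)
      push Not at h1 h2
      have a1 : χ t * η t ^ k ≤ (T t) ^ (1 / p) := by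
        rw [one_div]
        rw [Real.le_rpow_inv_iff_of_pos (mul_nonneg (χ0 t) (pow_nonneg (η0 t) _)) (T0 t)
          (by linarith)]
        rw [Real.mul_rpow (χ0 t) (pow_nonneg (η0 t) _)]
        have b1 : χ t ^ p ≤ χ t := Real.rpow_le_self_of_le_one (χ0 t) (χ1 t) hp.le
        have b2 : (η t ^ k) ^ p ≤ η t ^ (k + 1) := by
          rw [← Real.rpow_natCast, ← Real.rpow_mul (η0 t), ← Real.rpow_natCast (η t) (k + 1)]
          apply Real.rpow_le_rpow_of_exponent_ge' (η0 t) (η1 t) (by positivity)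
          push_cast; exact hkp
        have b3 := E1 t (by linarith)
        calc χ t ^ p * (η t ^ k) ^ p ≤ χ t * η t ^ (k + 1) := by
              have := χ0 t
              have := pow_nonneg (η0 t) k
              gcongr
          _ = χ t * 1 * η t ^ (k + 1) := by ring
          _ ≤ T t := by
              simp only [hT]
              have := χ0 t
              have := pow_nonneg (η0 t) (k + 1)
              gcongr
      calc χ t * E t * η t ^ k = E t * (χ t * η t ^ k) := by ring
        _ ≤ Real.exp Λ * (T t) ^ (1 / p) :=
          mul_le_mul (Eb t h2.le) a1 (mul_nonneg (χ0 t) (pow_nonneg (η0 t) _)) (Real.exp_nonneg _)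
    have a2 : 0 ≤ χ t * E t * η t ^ k :=
      mul_nonneg (mul_nonneg (χ0 t) (E0 t).le) (pow_nonneg (η0 t) _)
    have a3 : -((k + 1) * (4 / 3 * C / R ^ 2) * (Real.exp Λ * (T t) ^ (1 / p)))
        ≤ χ t * E t * (((k + 1 : ℕ) : ℝ) * η t ^ k * dη t) := by
      calc -((k + 1) * (4 / 3 * C / R ^ 2) * (Real.exp Λ * (T t) ^ (1 / p)))
          ≤ -((k + 1) * (4 / 3 * C / R ^ 2) * (χ t * E t * η t ^ k)) := by
            rw [neg_le_neg_iff]; gcongr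
        _ = (χ t * E t * η t ^ k * (k + 1)) * -(4 / 3 * C / R ^ 2) := by ring
        _ ≤ (χ t * E t * η t ^ k * (k + 1)) * dη t :=
            mul_le_mul_of_nonneg_left (dηb t) (by positivity)
        _ = _ := by push_cast; ring
    have a4 : (k + 1) * (4 / 3 * C) * Real.exp Λ / R ^ 2 * (T t) ^ (1 / p)
      = (k + 1) * (4 / 3 * C / R ^ 2) * (Real.exp Λ * (T t) ^ (1 / p)) := by ring
    rw [a4]
    linarith

lemma integral_mono_le_aux {X : Type*} [MeasurableSpace X] {μ : Measure X} {f g : X → ℝ}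
    (h : ∀ x, f x ≤ g x) (hg : Integrable g μ) (hg0 : ∀ x, 0 ≤ g x) :
    ∫ x, f x ∂μ ≤ ∫ x, g x ∂μ := by
  by_cases hf : Integrable f μ
  · exact integral_mono hf hg h
  · rw [integral_undef hf]
    exact integral_nonneg hg0

lemma young_param (p : ℝ) (hp : 1 < p) (a v f d l : ℝ) (ha : 0 ≤ a) (hv : 0 < v) (hf : 0 ≤ f)
    (hd : 0 ≤ d) (hl : 0 < l) :
    a * (d * f ^ (1 / p)) ≤ l * (a ^ p * v * f)
      + d ^ (p / (p - 1)) * l ^ (-(1 / (p - 1))) * v ^ (-(1 / (p - 1))) := by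
  have hp0 : 0 < p := by linarith
  have hp1 : 0 < p - 1 := by linarith
  have hq : p.HolderConjugate (p / (p - 1)) := Real.HolderConjugate.conjExponent hp
  have hlv : 0 < l * v := by positivity
  have hA : 0 ≤ (l * v) ^ (1 / p) * f ^ (1 / p) * a := by positivity
  have hB : 0 ≤ d * (l * v) ^ (-(1 / p)) := by positivity
  have key := Real.young_inequality_of_nonneg hA hB hq
  have e1 : (l * v) ^ (1 / p) * f ^ (1 / p) * a * (d * (l * v) ^ (-(1 / p)))
      = a * (d * f ^ (1 / p)) := by
    have : (l * v) ^ (1 / p) * (l * v) ^ (-(1 / p)) = 1 := by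
      rw [← Real.rpow_add hlv]; simp
    calc _ = ((l * v) ^ (1 / p) * (l * v) ^ (-(1 / p))) * (a * (d * f ^ (1 / p))) := by ring
      _ = _ := by rw [this, one_mul]
  have e2 : ((l * v) ^ (1 / p) * f ^ (1 / p) * a) ^ p = l * (a ^ p * v * f) := by
    rw [Real.mul_rpow (by positivity) ha, Real.mul_rpow (by positivity) (by positivity),
      ← Real.rpow_mul hlv.le, ← Real.rpow_mul hf, one_div_mul_cancel hp0.ne', Real.rpow_one,
      Real.rpow_one]
    ring
  have e3 : (d * (l * v) ^ (-(1 / p))) ^ (p / (p - 1))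
      = d ^ (p / (p - 1)) * l ^ (-(1 / (p - 1))) * v ^ (-(1 / (p - 1))) := by
    rw [Real.mul_rpow hd (by positivity), ← Real.rpow_mul hlv.le]
    have : -(1 / p) * (p / (p - 1)) = -(1 / (p - 1)) := by field_simp
    rw [this, Real.mul_rpow hl.le hv.le]
    ring
  rw [e1, e2, e3] at key
  refine key.trans (add_le_add ?_ ?_)
  · exact div_le_self (by positivity) hp.le
  · apply div_le_self (by positivity)
    rw [le_div_iff₀ hp1]; linarith

lemma real_limit (a : ℕ → ℝ) (hm : Monotone a) (B : ℝ) (hB : ∀ k, a k ≤ B) (κ M K r : ℝ)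
    (hκ : 0 < κ) (hr : 0 < r)
    (h : ∀ k, ∀ l > 0, κ * a k ≤ l * (M * (a (k + 1) - a k)) + K * l ^ (-r)) : ∀ k, a k ≤ 0 := by
  have hbdd : BddAbove (range a) := ⟨B, by rintro _ ⟨k, rfl⟩; exact hB k⟩
  have ht := tendsto_atTop_ciSup hm hbdd
  set L := ⨆ k, a k with hL
  have h1 : ∀ l > 0, κ * L ≤ K * l ^ (-r) := by
    intro l hl
    have t1 : Tendsto (fun k => κ * a k) atTop (𝓝 (κ * L)) := ht.const_mul κ
    have t2 : Tendsto (fun k => l * (M * (a (k + 1) - a k)) + K * l ^ (-r)) atTop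
        (𝓝 (l * (M * (L - L)) + K * l ^ (-r))) :=
      (((((tendsto_add_atTop_iff_nat 1).2 ht).sub ht).const_mul M).const_mul l).add_const _
    have := le_of_tendsto_of_tendsto' t1 t2 (fun k => h k l hl)
    simpa using this
  have h2 : κ * L ≤ 0 := by
    have t : Tendsto (fun l : ℝ => K * l ^ (-r)) atTop (𝓝 (K * 0)) :=
      (tendsto_rpow_neg_atTop hr).const_mul K
    rw [mul_zero] at t
    exact ge_of_tendsto t ((eventually_gt_atTop 0).mono fun l hl => h1 l hl)
  intro k
  have : a k ≤ L := le_ciSup hbdd k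
  nlinarith

lemma key1 {n : ℕ} (p : ℝ) (hp : 1 < p) : ∃ c > 0, ∃ M > 0,
    ∀ (w F : EuclideanSpace ℝ (Fin n) × ℝ → ℝ), Continuous w → Continuous F → (∀ z, 0 ≤ w z) →
    ∀ δ > 0, (∀ q : EuclideanSpace ℝ (Fin n) × ℝ, δ < q.2 → ∀ ε > 0,
      ∀ᶠ s in 𝓝[>] (0:ℝ), F q - ε ≤ Dh w s q) →
    ∀ (x₀ : EuclideanSpace ℝ (Fin n)) (R : ℝ), 0 < R →
    ∃ φ : EuclideanSpace ℝ (Fin n) × ℝ → ℝ, Continuous φ ∧ HasCompactSupport φ ∧ (∀ z, 0 ≤ φ z) ∧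
      (∀ z, φ z ≤ M) ∧
      (∀ z : EuclideanSpace ℝ (Fin n) × ℝ, z.1 ∈ Metric.closedBall x₀ (R / 2) → 3 * δ ≤ z.2 →
        z.2 ≤ R ^ 2 / 4 → (3 / 4) ^ 3 ≤ φ z) ∧
      ∫ z, φ z * F z ≤ ∫ z in Metric.ball x₀ R ×ˢ Ioc (R ^ 2 / 4) (R ^ 2),
        w z * (c / R ^ 2 * φ z ^ (1 / p)) := by
  set Λ : ℝ := ((24 + 6 * n : ℝ)) ^ 2 / 96 with hΛ
  have hΛ0 : 0 ≤ Λ := by positivity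
  obtain ⟨c, hc, H⟩ := time_fun p Λ hp hΛ0
  refine ⟨c, hc, Real.exp Λ, Real.exp_pos _, ?_⟩
  intro w F hw hF hw0 δ hδ hD x₀ R hR
  obtain ⟨T, T', cT, dT, T0, TM, Tz, Tz2, T1, Tlow, Tlow2⟩ := H δ hδ R hR
  obtain ⟨cφ, dφ⟩ := test_derivs x₀ R hR T T' cT dT
  set φ := fun z : EuclideanSpace ℝ (Fin n) × ℝ => T z.2 * (max (hgt x₀ R z.1) 0) ^ 3 with hφ
  have hg1 : ∀ x, hgt x₀ R x ≤ 1 := by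
    intro x; unfold hgt
    have : 0 ≤ ‖x - x₀‖ ^ 2 / R ^ 2 := by positivity
    linarith
  have hg0 : ∀ x, R ≤ ‖x - x₀‖ → hgt x₀ R x ≤ 0 := by
    intro x hx; unfold hgt
    have : 1 ≤ ‖x - x₀‖ ^ 2 / R ^ 2 := by
      rw [le_div_iff₀ (by positivity), one_mul]; gcongr
    linarith
  have ψ0 : ∀ x, 0 ≤ (max (hgt x₀ R x) 0) ^ 3 := fun x => pow_nonneg (le_max_right _ _) _
  have ψ1 : ∀ x, (max (hgt x₀ R x) 0) ^ 3 ≤ 1 := fun x =>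
    pow_le_one₀ (le_max_right _ _) (max_le (hg1 x) zero_le_one)
  have φ0 : ∀ z, 0 ≤ φ z := fun z => mul_nonneg (T0 _) (ψ0 _)
  have hcs : HasCompactSupport φ := by
    refine HasCompactSupport.intro
      ((isCompact_closedBall x₀ R).prod (isCompact_Icc (a := 2 * δ) (b := R ^ 2))) ?_
    rintro ⟨x, t⟩ hz
    simp only [hφ]
    by_cases hx : R ≤ ‖x - x₀‖
    · rw [max_eq_right (hg0 x hx)]; simp
    · by_cases h1 : t ≤ 2 * δ
      · rw [Tz t h1, zero_mul]
      · by_cases h2 : R ^ 2 ≤ t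
        · rw [Tz2 t h2, zero_mul]
        · push Not at hx h1 h2
          exact absurd ⟨by simpa [dist_eq_norm] using hx.le, h1.le, h2.le⟩ hz
  have hsub : tsupport φ ⊆ {z : EuclideanSpace ℝ (Fin n) × ℝ | δ < z.2} := by
    have : tsupport φ ⊆ {z : EuclideanSpace ℝ (Fin n) × ℝ | 2 * δ ≤ z.2} := by
      apply closure_minimal _ (isClosed_le continuous_const continuous_snd)
      intro z hz
      by_contra h
      simp only [mem_ofPred_eq, not_le] at h
      exact hz (by simp only [hφ, Tz z.2 h.le, zero_mul])
    intro z hz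
    have := this hz
    simp only [mem_ofPred_eq] at this ⊢
    linarith
  refine ⟨φ, cφ.continuous, hcs, φ0, ?_, ?_, ?_⟩
  · intro z
    calc φ z ≤ Real.exp Λ * 1 := mul_le_mul (TM _) (ψ1 _) (ψ0 _) (Real.exp_nonneg _)
      _ = _ := mul_one _
  · intro z hz h1 h2
    have h3 : 3 / 4 ≤ hgt x₀ R z.1 := by
      unfold hgt
      have hz' : ‖z.1 - x₀‖ ≤ R / 2 := by simpa [dist_eq_norm] using hz
      have : ‖z.1 - x₀‖ ^ 2 / R ^ 2 ≤ 1 / 4 := by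
        rw [div_le_iff₀ (by positivity)]
        nlinarith [norm_nonneg (z.1 - x₀)]
      linarith
    have h4 : (3 / 4 : ℝ) ^ 3 ≤ (max (hgt x₀ R z.1) 0) ^ 3 := by
      gcongr; exact h3.trans (le_max_left _ _)
    calc (3 / 4 : ℝ) ^ 3 ≤ 1 * (max (hgt x₀ R z.1) 0) ^ 3 := by linarith
      _ ≤ φ z := mul_le_mul_of_nonneg_right (T1 _ h1 h2) (ψ0 _)
  · have hwk := weak_ineq w F φ hw hF cφ φ0 hcs {z | δ < z.2}
      (isOpen_lt continuous_const continuous_snd) hsub hD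
    refine hwk.trans ?_
    have hP : MeasurableSet (Metric.ball x₀ R ×ˢ Ioc (R ^ 2 / 4) (R ^ 2)) :=
      measurableSet_ball.prod measurableSet_Ioc
    rw [← integral_indicator hP]
    have hp0 : 0 < 1 / p := by apply one_div_pos.2; linarith
    have cont : Continuous (fun z => w z * (c / R ^ 2 * φ z ^ (1 / p))) :=
      hw.mul (continuous_const.mul (cφ.continuous.rpow_const fun _ => Or.inr hp0.le))
    have rhs0 : ∀ z, 0 ≤ w z * (c / R ^ 2 * φ z ^ (1 / p)) := fun z =>
      mul_nonneg (hw0 z) (mul_nonneg (by positivity) (Real.rpow_nonneg (φ0 z) _))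
    have ind0 : ∀ z, 0 ≤ (Metric.ball x₀ R ×ˢ Ioc (R ^ 2 / 4) (R ^ 2)).indicator
        (fun z => w z * (c / R ^ 2 * φ z ^ (1 / p))) z := fun z =>
      indicator_nonneg (fun z _ => rhs0 z) z
    have int : Integrable ((Metric.ball x₀ R ×ˢ Ioc (R ^ 2 / 4) (R ^ 2)).indicator
        (fun z => w z * (c / R ^ 2 * φ z ^ (1 / p)))) := by
      rw [integrable_indicator_iff hP]
      refine IntegrableOn.mono_set (cont.continuousOn.integrableOn_compact
        ((isCompact_closedBall x₀ R).prod (isCompact_Icc (a := R ^ 2 / 4) (b := R ^ 2)))) ?_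
      exact prod_mono Metric.ball_subset_closedBall Ioc_subset_Icc_self
    refine integral_mono_le_aux ?_ int ind0
    intro z
    obtain ⟨d1, d2⟩ := dφ z
    rw [d1, d2]
    have hl := lap_lower n (hgt x₀ R z.1)
    rw [← hΛ] at hl
    have hl2 : -(Λ / R ^ 2 * T z.2 * (max (hgt x₀ R z.1) 0) ^ 3) ≤
        T z.2 * ((24 * (max (hgt x₀ R z.1) 0) * (1 - hgt x₀ R z.1)
            - 6 * n * (max (hgt x₀ R z.1) 0) ^ 2) / R ^ 2) := by
      calc -(Λ / R ^ 2 * T z.2 * (max (hgt x₀ R z.1) 0) ^ 3)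
          = T z.2 * ((-Λ * (max (hgt x₀ R z.1) 0) ^ 3) / R ^ 2) := by ring
        _ ≤ _ := by
          apply mul_le_mul_of_nonneg_left _ (T0 _)
          gcongr
    by_cases hz : z ∈ Metric.ball x₀ R ×ˢ Ioc (R ^ 2 / 4) (R ^ 2)
    · rw [indicator_of_mem hz]
      apply mul_le_mul_of_nonneg_left _ (hw0 z)
      have b1 := mul_le_mul_of_nonneg_right (Tlow2 z.2) (ψ0 z.1)
      have b2 : (T z.2) ^ (1 / p) * (max (hgt x₀ R z.1) 0) ^ 3 ≤ φ z ^ (1 / p) := by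
        simp only [hφ]
        rw [Real.mul_rpow (T0 _) (ψ0 _)]
        apply mul_le_mul_of_nonneg_left _ (Real.rpow_nonneg (T0 _) _)
        apply Real.self_le_rpow_of_le_one (ψ0 _) (ψ1 _)
        rw [div_le_one (by linarith)]; exact hp.le
      have b3 : c / R ^ 2 * ((T z.2) ^ (1 / p) * (max (hgt x₀ R z.1) 0) ^ 3)
          ≤ c / R ^ 2 * φ z ^ (1 / p) := by gcongr
      linarith
    · rw [indicator_of_notMem hz]
      apply mul_nonpos_of_nonneg_of_nonpos (hw0 z)
      by_cases h1 : z.2 ≤ R ^ 2 / 4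
      · have b1 := mul_le_mul_of_nonneg_right (Tlow z.2 h1) (ψ0 z.1)
        linarith
      by_cases hx : R ≤ ‖z.1 - x₀‖
      · rw [max_eq_right (hg0 _ hx)]; simp
      have h2 : R ^ 2 < z.2 := by
        by_contra h
        push Not at hx h1 h
        exact hz ⟨by simpa [dist_eq_norm] using hx, h1, h⟩
      have t1 : T' z.2 = 0 := by
        have e : T =ᶠ[𝓝 z.2] fun _ => 0 := by
          filter_upwards [lt_mem_nhds h2] with y hy
          exact Tz2 y hy.le
        exact (dT z.2).unique ((hasDerivAt_const z.2 (0:ℝ)).congr_of_eventuallyEq e)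
      rw [t1, Tz2 z.2 h2.le]; simp

lemma liouville_aux {n : ℕ} (p α : ℝ) (hp : 1 < p) (hα : 0 < α) (hpα : p ≤ 1 + 2 / α)
    (w v : EuclideanSpace ℝ (Fin n) × ℝ → ℝ) (hw : Continuous w) (hv : Continuous v)
    (hw0 : ∀ z, 0 ≤ w z) (hv0 : ∀ z, 0 < v z) (δ : ℝ) (hδ : 0 < δ)
    (hD : ∀ q : EuclideanSpace ℝ (Fin n) × ℝ, δ < q.2 → ∀ ε > 0,
      ∀ᶠ s in 𝓝[>] (0:ℝ), w q ^ p * v q - ε ≤ Dh w s q)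
    (x₀ : EuclideanSpace ℝ (Fin n)) (C R₀ : ℝ) (hC : 0 < C)
    (hvol : ∀ R, R₀ ≤ R → ∫ z in Metric.ball x₀ R ×ˢ Ioc (R ^ 2 / 4) (R ^ 2),
      v z ^ (-(1 / (p - 1))) ≤ C * R ^ (2 + α)) :
    ∀ z : EuclideanSpace ℝ (Fin n) × ℝ, 3 * δ < z.2 → w z = 0 := by
  have hp0 : 0 < p := by linarith
  have hp1 : 0 < p - 1 := by linarith
  obtain ⟨c, hc, M, hM, H⟩ := key1 (n := n) p hp
  set F : EuclideanSpace ℝ (Fin n) × ℝ → ℝ := fun z => w z ^ p * v z with hFdef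
  have hF : Continuous F := (hw.rpow_const fun _ => Or.inr hp0.le).mul hv
  have hF0 : ∀ z, 0 ≤ F z := fun z => mul_nonneg (Real.rpow_nonneg (hw0 z) _) (hv0 z).le
  have H1 := H w F hw hF hw0 δ hδ hD x₀
  set P : ℝ → Set (EuclideanSpace ℝ (Fin n) × ℝ) :=
    fun R => Metric.ball x₀ R ×ˢ Ioc (R ^ 2 / 4) (R ^ 2) with hP
  set Bx : ℝ → Set (EuclideanSpace ℝ (Fin n) × ℝ) :=
    fun R => Metric.closedBall x₀ (R / 2) ×ˢ Icc (3 * δ) (R ^ 2 / 4) with hBx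
  have mP : ∀ R, MeasurableSet (P R) := fun R => measurableSet_ball.prod measurableSet_Ioc
  have mB : ∀ R, MeasurableSet (Bx R) := fun R =>
    Metric.isClosed_closedBall.measurableSet.prod measurableSet_Icc
  have iP : ∀ R (f : EuclideanSpace ℝ (Fin n) × ℝ → ℝ), Continuous f → IntegrableOn f (P R) := by
    intro R f hf
    refine IntegrableOn.mono_set (hf.continuousOn.integrableOn_compact
        ((isCompact_closedBall x₀ R).prod (isCompact_Icc (a := R ^ 2 / 4) (b := R ^ 2)))) ?_
    exact prod_mono Metric.ball_subset_closedBall Ioc_subset_Icc_self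
  have iB : ∀ R (f : EuclideanSpace ℝ (Fin n) × ℝ → ℝ), Continuous f → IntegrableOn f (Bx R) :=
    fun R f hf => hf.continuousOn.integrableOn_compact
      ((isCompact_closedBall x₀ (R / 2)).prod isCompact_Icc)
  set K : ℝ := c ^ (p / (p - 1)) * C with hK
  have hK0 : 0 < K := by positivity
  set r : ℝ := 1 / (p - 1) with hr
  have hr0 : 0 < r := by positivity
  set m : ℝ → ℝ := fun R => ∫ z in Bx R, F z with hm
  have hvr : Continuous (fun z => v z ^ (-r)) :=
    hv.rpow_const fun z => Or.inl (hv0 z).ne'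
  -- the main estimate
  have main : ∀ R, 1 ≤ R → R₀ ≤ R → 12 * δ ≤ R ^ 2 →
      m R * (3 / 4) ^ 3 ≤ 2 * (K * (1 / 2) ^ (-r)) ∧
      ∀ l > 0, (3 / 4) ^ 3 * m R ≤ l * (M * (m (4 * R) - m R)) + K * l ^ (-r) := by
    intro R hR1 hR0 hRδ
    have hR : 0 < R := by linarith
    obtain ⟨φ, cφ, hcs, φ0, φM, φl, hI⟩ := H1 R hR
    have iφF : Integrable (fun z => φ z * F z) :=
      (cφ.mul hF).integrable_of_hasCompactSupport hcs.mul_right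
    set A := ∫ z, φ z * F z with hA
    set J := ∫ z in P R, φ z * F z with hJ
    have hJA : J ≤ A :=
      setIntegral_le_integral iφF (Eventually.of_forall fun z => mul_nonneg (φ0 z) (hF0 z))
    have hmA : m R * (3 / 4) ^ 3 ≤ A := by
      calc m R * (3 / 4) ^ 3 = ∫ z in Bx R, F z * (3 / 4) ^ 3 := by
            rw [integral_mul_const]
        _ ≤ ∫ z in Bx R, φ z * F z := by
            refine setIntegral_mono_on (iB R _ (hF.mul continuous_const)) iφF.integrableOn (mB R) ?_
            rintro z ⟨hz1, hz2⟩
            rw [mul_comm]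
            exact mul_le_mul_of_nonneg_right (φl z hz1 hz2.1 hz2.2) (hF0 z)
        _ ≤ A := setIntegral_le_integral iφF
            (Eventually.of_forall fun z => mul_nonneg (φ0 z) (hF0 z))
    have hAl : ∀ l > 0, A ≤ l * J + K * l ^ (-r) := by
      intro l hl
      have i1 : IntegrableOn (fun z => l * (φ z * F z)) (P R) :=
        iP R _ (continuous_const.mul (cφ.mul hF))
      have i2 : IntegrableOn (fun z => (c / R ^ 2) ^ (p / (p - 1)) * l ^ (-r) * v z ^ (-r)) (P R) :=
        iP R _ (continuous_const.mul hvr)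
      have s1 : A ≤ ∫ z in P R, (l * (φ z * F z)
          + (c / R ^ 2) ^ (p / (p - 1)) * l ^ (-r) * v z ^ (-r)) := by
        refine hI.trans (integral_mono_le_aux ?_ (i1.add i2) ?_)
        · intro z
          have := young_param p hp (w z) (v z) (φ z) (c / R ^ 2) l (hw0 z) (hv0 z) (φ0 z)
            (by positivity) hl
          calc _ ≤ _ := this
            _ = _ := by simp only [hFdef, hr]; ring
        · intro z
          have h1 := mul_nonneg (φ0 z) (hF0 z)
          have h2 := (hv0 z).le
          positivity
      rw [integral_add i1 i2, integral_const_mul, integral_const_mul] at s1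
      refine s1.trans (add_le_add le_rfl ?_)
      have hq : p / (p - 1) = 1 + r := by rw [hr]; field_simp; ring
      have e1 : (c / R ^ 2) ^ (p / (p - 1)) * R ^ (2 + α) ≤ c ^ (p / (p - 1)) := by
        rw [Real.div_rpow hc.le (by positivity), div_mul_eq_mul_div,
          div_le_iff₀ (by positivity)]
        gcongr
        rw [← Real.rpow_natCast, ← Real.rpow_mul hR.le]
        apply Real.rpow_le_rpow_of_exponent_le hR1
        rw [hq]
        have : α ≤ 2 * r := by
          have h3 : p - 1 ≤ 2 / α := by linarith
          rw [le_div_iff₀ hα] at h3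
          rw [hr, mul_one_div, le_div_iff₀ hp1]; linarith
        push_cast; linarith
      calc (c / R ^ 2) ^ (p / (p - 1)) * l ^ (-r) * ∫ z in P R, v z ^ (-r)
          ≤ (c / R ^ 2) ^ (p / (p - 1)) * l ^ (-r) * (C * R ^ (2 + α)) := by
            gcongr; exact hvol R hR0
        _ = ((c / R ^ 2) ^ (p / (p - 1)) * R ^ (2 + α)) * (C * l ^ (-r)) := by ring
        _ ≤ c ^ (p / (p - 1)) * (C * l ^ (-r)) := by gcongr
        _ = _ := by rw [hK]; ring
    have hJm : J ≤ M * (m (4 * R) - m R) := by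
      calc J ≤ ∫ z in P R, M * F z := by
            refine setIntegral_mono iφF.integrableOn (iP R _ (continuous_const.mul hF)) ?_
            intro z
            exact mul_le_mul_of_nonneg_right (φM z) (hF0 z)
        _ = M * ∫ z in P R, F z := integral_const_mul _ _
        _ ≤ M * (m (4 * R) - m R) := by
            apply mul_le_mul_of_nonneg_left _ hM.le
            have hd : Disjoint (P R) (Bx R) := by
              rw [Set.disjoint_left]
              rintro z ⟨_, h1⟩ ⟨_, h2⟩
              exact absurd h1.1 (not_lt.2 h2.2)
            have hs : P R ∪ Bx R ⊆ Bx (4 * R) := by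
              rintro z (⟨h1, h2⟩ | ⟨h1, h2⟩)
              · refine ⟨?_, ?_, ?_⟩
                · rw [Metric.mem_ball] at h1
                  rw [Metric.mem_closedBall]; linarith
                · have := h2.1; linarith
                · have := h2.2; nlinarith
              · refine ⟨?_, h2.1, ?_⟩
                · rw [Metric.mem_closedBall] at h1 ⊢; linarith
                · have := h2.2; nlinarith
            have e := setIntegral_union hd (mB R) (iP R F hF) (iB R F hF)
            have e2 := setIntegral_mono_set (iB (4 * R) F hF)
              (Eventually.of_forall hF0) (LE.le.eventuallyLE hs)
            simp only [hm]
            linarith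
    constructor
    · have := hAl (1 / 2) (by norm_num)
      linarith
    · intro l hl
      have h1 := hAl l hl
      have h2 : l * J ≤ l * (M * (m (4 * R) - m R)) := by gcongr
      linarith
  -- `m` vanishes
  have mz : ∀ R, 1 ≤ R → R₀ ≤ R → 12 * δ ≤ R ^ 2 → m R ≤ 0 := by
    intro R hR1 hR0 hRδ
    have hk : ∀ k : ℕ, R ≤ 4 ^ k * R := fun k =>
      le_mul_of_one_le_left (by linarith) (one_le_pow₀ (by norm_num))
    have hmain : ∀ k : ℕ, _ := fun k : ℕ => main (4 ^ k * R) (hR1.trans (hk k)) (hR0.trans (hk k))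
      (hRδ.trans (by have := hk k; gcongr))
    have hmono : Monotone (fun k : ℕ => m (4 ^ k * R)) := by
      apply monotone_nat_of_le_succ
      intro k
      refine setIntegral_mono_set (iB _ F hF) (Eventually.of_forall hF0)
        (LE.le.eventuallyLE ?_)
      have h4 : (4:ℝ) ^ k * R ≤ 4 ^ (k + 1) * R := by
        gcongr
        · norm_num
        · omega
      have h5 : 0 ≤ (4:ℝ) ^ k * R := by positivity
      exact prod_mono (Metric.closedBall_subset_closedBall (by linarith))
        (Icc_subset_Icc_right (by gcongr))
    have := real_limit (fun k : ℕ => m (4 ^ k * R)) hmono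
      (2 * (K * (1 / 2) ^ (-r)) / (3 / 4) ^ 3)
      (fun k => by rw [le_div_iff₀ (by norm_num)]; exact (hmain k).1)
      ((3 / 4) ^ 3) M K r (by norm_num) hr0
      (fun k l hl => by
        have := (hmain k).2 l hl
        rw [show (4:ℝ) * (4 ^ k * R) = 4 ^ (k + 1) * R by ring] at this
        exact this) 0
    simpa using this
  intro z hz
  -- choose a large radius
  obtain ⟨R, hR1, hR0, hRδ, hRx, hRt⟩ : ∃ R : ℝ, 1 ≤ R ∧ R₀ ≤ R ∧ 12 * δ ≤ R ^ 2 ∧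
      dist z.1 x₀ < R / 2 ∧ z.2 < R ^ 2 / 4 := by
    have hd : 0 ≤ dist z.1 x₀ := dist_nonneg
    have hz2 : 0 < z.2 := by linarith
    refine ⟨1 + |R₀| + 12 * δ + 2 * dist z.1 x₀ + 4 * z.2, ?_, ?_, ?_, ?_, ?_⟩
    · have := abs_nonneg R₀; linarith
    · have := le_abs_self R₀; linarith
    · have := abs_nonneg R₀; nlinarith
    · have := abs_nonneg R₀; linarith
    · have := abs_nonneg R₀; nlinarith
  have hm0 : ∫ z in Bx R, F z = 0 :=
    le_antisymm (mz R hR1 hR0 hRδ) (integral_nonneg hF0)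
  rw [setIntegral_eq_zero_iff_of_nonneg_ae (Eventually.of_forall hF0) (iB R F hF)] at hm0
  set U : Set (EuclideanSpace ℝ (Fin n) × ℝ) :=
    Metric.ball x₀ (R / 2) ×ˢ Ioo (3 * δ) (R ^ 2 / 4) with hU
  have hUB : U ⊆ Bx R := prod_mono Metric.ball_subset_closedBall Ioo_subset_Icc_self
  have hUo : IsOpen U := Metric.isOpen_ball.prod isOpen_Ioo
  have hae : F =ᵐ[volume.restrict U] 0 := ae_restrict_of_ae_restrict_of_subset hUB hm0
  have hEq := Measure.eqOn_open_of_ae_eq hae hUo hF.continuousOn continuousOn_const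
  have hFz : F z = 0 := hEq (show z ∈ U from ⟨hRx, hz, hRt⟩)
  have h1 : w z ^ p = 0 := (mul_eq_zero.1 hFz).resolve_right (hv0 z).ne'
  exact (Real.rpow_eq_zero (hw0 z) hp0.ne').1 h1

lemma heat_Dh_tendsto {n : ℕ} (u : EuclideanSpace ℝ (Fin n) → ℝ → ℝ)
    (w : EuclideanSpace ℝ (Fin n) × ℝ → ℝ) (hw : ∀ z, 0 < z.2 → w z = u z.1 z.2)
    (hu_space : ∀ t : ℝ, 0 < t → ContDiff ℝ 2 (fun x => u x t))
    (hu_time : ∀ x, ContDiffOn ℝ 1 (fun s => u x s) (Ioi 0))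
    (q : EuclideanSpace ℝ (Fin n) × ℝ) (hq : 0 < q.2) :
    Tendsto (fun s => Dh w s q) (𝓝[>] 0)
      (𝓝 (deriv (fun s => u q.1 s) q.2 - laplacian (fun y => u y q.2) q.1)) := by
  unfold laplacian
  apply Dh_tendsto
  · have h1 : DifferentiableAt ℝ (fun s => u q.1 s) q.2 :=
      ((hu_time q.1).differentiableOn (by norm_num)).differentiableAt (Ioi_mem_nhds hq)
    refine h1.hasDerivAt.congr_of_eventuallyEq ?_
    filter_upwards [lt_mem_nhds hq] with s hs
    exact hw (q.1, s) hs
  · intro i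
    have hs := hu_space q.2 hq
    set f := fun x => u x q.2 with hf
    set e : EuclideanSpace ℝ (Fin n) := EuclideanSpace.single i 1 with he
    have hline : ∀ s : ℝ, HasDerivAt (fun s : ℝ => q.1 + s • e) e s := by
      intro s
      have := ((hasDerivAt_id s).smul_const e).const_add q.1
      simpa using this
    have hd1 : Differentiable ℝ f := hs.differentiable (by norm_num)
    have hd2 : Differentiable ℝ (fun y => fderiv ℝ f y e) := by
      have : ContDiff ℝ 1 (fderiv ℝ f) := hs.fderiv_right (by norm_num)
      exact (this.differentiable (by norm_num)).clm_apply (differentiable_const _)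
    refine ⟨fun s => fderiv ℝ f (q.1 + s • e) e, ?_, ?_⟩
    · intro s
      have e1 : (fun s : ℝ => w (q.1 + s • e, q.2)) = fun s => f (q.1 + s • e) := by
        funext s; exact hw _ hq
      rw [e1]
      exact (hd1 (q.1 + s • e)).hasFDerivAt.comp_hasDerivAt s (hline s)
    · have h0 : q.1 + (0:ℝ) • e = q.1 := by simp
      have := (hd2 (q.1 + (0:ℝ) • e)).hasFDerivAt.comp_hasDerivAt (0:ℝ) (hline 0)
      rw [h0] at this
      exact this

/-- Liouville theorem for bounded-below classical solutions of `u_t = Δu + |u|^p V` on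
`ℝⁿ × (0,∞)` with nonnegative initial datum, under the (VOL) conditions on the weight `V`
with exponent `α`, for `1 < p ≤ 1 + 2/α`. -/
theorem triviality_weighted_superlinear_heat_equation
    {n : ℕ} (p α : ℝ) (hp : 1 < p) (hα : 0 < α) (hpα : p ≤ 1 + 2 / α)
    (u V : EuclideanSpace ℝ (Fin n) → ℝ → ℝ)
    -- u is continuous up to t = 0
    (hu_cont : ContinuousOn (fun q : EuclideanSpace ℝ (Fin n) × ℝ => u q.1 q.2)
      {q : EuclideanSpace ℝ (Fin n) × ℝ | 0 ≤ q.2})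
    -- u is C² in the space variable for every t > 0
    (hu_space : ∀ t : ℝ, 0 < t → ContDiff ℝ 2 (fun x => u x t))
    -- u is C¹ in the time variable on (0,∞)
    (hu_time : ∀ x, ContDiffOn ℝ 1 (fun s => u x s) (Ioi 0))
    -- V is continuous on ℝⁿ × (0,∞)
    (hV_cont : ContinuousOn (fun q : EuclideanSpace ℝ (Fin n) × ℝ => V q.1 q.2)
      {q : EuclideanSpace ℝ (Fin n) × ℝ | 0 < q.2})
    -- V is positive
    (hV_pos : ∀ x, ∀ t : ℝ, 0 < t → 0 < V x t)
    -- u is bounded from below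
    (hbelow : ∃ A : ℝ, ∀ x, ∀ t : ℝ, 0 ≤ t → A ≤ u x t)
    -- nonnegative initial datum
    (h0 : ∀ x, 0 ≤ u x 0)
    -- u solves u_t = Δu + |u|^p V on ℝⁿ × (0,∞)
    (hpde : ∀ x, ∀ t : ℝ, 0 < t →
      deriv (fun s => u x s) t = laplacian (fun y => u y t) x + |u x t| ^ p * V x t)
    -- the conditions (VOL) with exponent α
    (hVOL : ∃ x₀ : EuclideanSpace ℝ (Fin n), ∃ C R₀ : ℝ, 0 < C ∧ 0 < R₀ ∧
      ∀ R : ℝ, R₀ ≤ R →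
        (∫ t in Ioc (R ^ 2 / 4) (R ^ 2), ∫ x in Metric.ball x₀ R,
            V x t ^ (-(1 / (p - 1)))) ≤ C * R ^ (2 + α) ∧
        (∫ t in Ioc (0 : ℝ) (R ^ 2), ∫ x in Metric.ball x₀ R \ Metric.ball x₀ (R / 2),
            V x t ^ (-(1 / (p - 1)))) ≤ C * R ^ (2 + α)) :
    ∀ x, ∀ t : ℝ, 0 ≤ t → u x t = 0 := by
  have hp0 : 0 < p := by linarith
  have hp1 : 0 < p - 1 := by linarith
  obtain ⟨A, hA⟩ := hbelow
  obtain ⟨x₀, C, R₀, hC, hR₀, hvol⟩ := hVOL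
  have hnn : ∀ x, ∀ t : ℝ, 0 ≤ t → 0 ≤ u x t := by
    have := min_principle (fun q : EuclideanSpace ℝ (Fin n) × ℝ => u q.1 q.2) hu_cont A
      (fun q hq => hA q.1 q.2 hq) (fun q hq => by simpa [hq] using h0 q.1)
      (fun q hq ε hε => by
        have ht := heat_Dh_tendsto u (fun q => u q.1 q.2) (fun z _ => rfl) hu_space hu_time q hq
        have : -ε < deriv (fun s => u q.1 s) q.2 - laplacian (fun y => u y q.2) q.1 := by
          rw [hpde q.1 q.2 hq]
          have := mul_nonneg (Real.rpow_nonneg (abs_nonneg (u q.1 q.2)) p) (hV_pos q.1 q.2 hq).le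
          linarith
        filter_upwards [ht.eventually (lt_mem_nhds this)] with s hs
        exact hs.le)
    exact fun x t ht => this (x, t) ht
  have hcu : Continuous (fun z : EuclideanSpace ℝ (Fin n) × ℝ => u z.1 (max z.2 0)) := by
    have : Continuous (fun z : EuclideanSpace ℝ (Fin n) × ℝ => (z.1, max z.2 0)) := by fun_prop
    exact hu_cont.comp_continuous this (fun z => show (0:ℝ) ≤ max z.2 0 from le_max_right _ _)
  have hpos : ∀ x, ∀ t : ℝ, 0 < t → u x t = 0 := by
    intro x t ht
    set δ := t / 4 with hδ
    have hδ0 : 0 < δ := by positivity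
    have hcv : Continuous (fun z : EuclideanSpace ℝ (Fin n) × ℝ => V z.1 (max z.2 δ)) := by
      have : Continuous (fun z : EuclideanSpace ℝ (Fin n) × ℝ => (z.1, max z.2 δ)) := by fun_prop
      exact hV_cont.comp_continuous this (fun z => lt_of_lt_of_le hδ0 (le_max_right _ _))
    have hv0 : ∀ z : EuclideanSpace ℝ (Fin n) × ℝ, 0 < V z.1 (max z.2 δ) := fun z =>
      hV_pos _ _ (lt_of_lt_of_le hδ0 (le_max_right _ _))
    have key := liouville_aux p α hp hα hpα
      (fun z : EuclideanSpace ℝ (Fin n) × ℝ => u z.1 (max z.2 0)) (fun z => V z.1 (max z.2 δ))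
      hcu hcv (fun z => hnn _ _ (le_max_right _ _)) hv0 δ hδ0
      (fun q hq ε hε => by
        have hq0 : 0 < q.2 := hδ0.trans hq
        have ht := heat_Dh_tendsto u (fun z => u z.1 (max z.2 0))
          (fun z hz => by simp only [max_eq_left hz.le]) hu_space hu_time q hq0
        have : u q.1 (max q.2 0) ^ p * V q.1 (max q.2 δ) - ε
            < deriv (fun s => u q.1 s) q.2 - laplacian (fun y => u y q.2) q.1 := by
          rw [hpde q.1 q.2 hq0, max_eq_left hq0.le, max_eq_left hq.le,
            abs_of_nonneg (hnn q.1 q.2 hq0.le)]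
          linarith
        filter_upwards [ht.eventually (lt_mem_nhds this)] with s hs
        exact hs.le)
      x₀ C (max R₀ (1 + 4 * δ)) hC
      (fun R hR => by
        have hR1 := (le_max_left _ _).trans hR
        have hR2 := (le_max_right _ _).trans hR
        have hRδ : δ ≤ R ^ 2 / 4 := by nlinarith
        refine le_trans (le_of_eq ?_) (hvol R hR1).1
        have hVint : IntegrableOn (fun z : EuclideanSpace ℝ (Fin n) × ℝ =>
            V z.1 (max z.2 δ) ^ (-(1 / (p - 1))))
            (Metric.ball x₀ R ×ˢ Ioc (R ^ 2 / 4) (R ^ 2)) := by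
          have hc : Continuous (fun z : EuclideanSpace ℝ (Fin n) × ℝ =>
            V z.1 (max z.2 δ) ^ (-(1 / (p - 1)))) :=
            hcv.rpow_const fun z => Or.inl (hv0 z).ne'
          refine IntegrableOn.mono_set (hc.continuousOn.integrableOn_compact
            ((isCompact_closedBall x₀ R).prod (isCompact_Icc (a := R ^ 2 / 4) (b := R ^ 2)))) ?_
          exact prod_mono Metric.ball_subset_closedBall Ioc_subset_Icc_self
        rw [IntegrableOn, Measure.volume_eq_prod, ← Measure.prod_restrict] at hVint
        rw [Measure.volume_eq_prod, ← Measure.prod_restrict, integral_prod_symm _ hVint]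
        refine setIntegral_congr_fun measurableSet_Ioc ?_
        intro s hs
        have : δ ≤ s := hRδ.trans hs.1.le
        simp only [max_eq_left this])
    have := key (x, t) (by simp only [hδ]; linarith)
    simpa [max_eq_left ht.le] using this
  intro x t ht
  rcases ht.eq_or_lt with h | h
  · subst h
    have hc : Continuous (fun s : ℝ => u x (max s 0)) :=
      hcu.comp (by fun_prop : Continuous fun s : ℝ => (x, s))
    have t1 : Tendsto (fun s : ℝ => u x (max s 0)) (𝓝[>] 0) (𝓝 (u x (max 0 0))) :=
      (hc.tendsto 0).mono_left nhdsWithin_le_nhds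
    have t2 : Tendsto (fun s : ℝ => u x (max s 0)) (𝓝[>] 0) (𝓝 0) := by
      refine Tendsto.congr' ?_ tendsto_const_nhds
      filter_upwards [self_mem_nhdsWithin] with s hs
      have hs0 : (0:ℝ) < s := hs
      rw [max_eq_left hs0.le, hpos x s hs0]
    have := tendsto_nhds_unique t1 t2
    simpa using this
  · exact hpos x t h
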